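/- Let d = 2 and define ω : ℝ² → ℝ by ω(x) = √(1 + Σ_{j=1}^{2} 2(1 − cos x_j)). For λ ∈ ℝ and s ∈ ℝ², set J(λ,s) = ∫_{[0,2π]²} e^{iλ(ω(x) − s·x)} dx. Then there exists a constant C > 0, independent of λ and s, such that |J(λ,s)| ≤ C(1 + |λ|)^{-3/4} for all λ ∈ ℝ and all s ∈ ℝ². -/

import Mathlib

open MeasureTheory Real
open scoped ENNReal

noncomputable section

/-- Dispersion relation of the discrete Klein--Gordon equation on `ℤ^d`. -/
def omegaKG (d : ℕ) (x : Fin d → ℝ) : ℝ :=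
  Real.sqrt (1 + ∑ j : Fin d, 2 * (1 - Real.cos (x j)))

/-- The fundamental domain `[0, 2π]^d` of the torus. -/
def cube (d : ℕ) : Set (Fin d → ℝ) := Set.Icc 0 (fun _ => 2 * Real.pi)

/-- The oscillatory integral `J(λ,s) = ∫_{[0,2π]^d} e^{iλ(ω(x) − s·x)} dx`. -/
def oscIntJ (d : ℕ) (lam : ℝ) (s : Fin d → ℝ) : ℂ :=
  ∫ x in cube d,
    Complex.exp (Complex.I * ((lam * (omegaKG d x - ∑ j : Fin d, s j * x j) : ℝ) : ℂ))

/-- `f 0, f 1, …, f k` are successive derivatives of `f 0` on `[a, b]`. -/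
def DerivChain (f : ℕ → ℝ → ℝ) (k : ℕ) (a b : ℝ) : Prop :=
  ∀ j < k, ∀ t ∈ Set.Icc a b, HasDerivAt (f j) (f (j + 1) t) t

/-- `g` has a constant (weak) sign on `[a, b]`. -/
def ConstSign (g : ℝ → ℝ) (a b : ℝ) : Prop :=
  (∀ t ∈ Set.Icc a b, 0 ≤ g t) ∨ (∀ t ∈ Set.Icc a b, g t ≤ 0)

lemma DerivChain.mono {f : ℕ → ℝ → ℝ} {k k' : ℕ} {a b a' b' : ℝ} (h : DerivChain f k a b)
    (hk : k' ≤ k) (ha : a ≤ a') (hb : b' ≤ b) : DerivChain f k' a' b' :=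
  fun j hj t ht => h j (hj.trans_le hk) t ⟨ha.trans ht.1, ht.2.trans hb⟩

lemma DerivChain.continuousOn {f : ℕ → ℝ → ℝ} {k : ℕ} {a b : ℝ} (h : DerivChain f k a b) {j : ℕ}
    (hj : j < k) : ContinuousOn (f j) (Set.Icc a b) :=
  fun t ht => (h j hj t ht).continuousAt.continuousWithinAt

lemma monotoneOn_or_antitoneOn_of_constSign {f g : ℝ → ℝ} {a b : ℝ}
    (h : ∀ t ∈ Set.Icc a b, HasDerivAt f (g t) t) (hg : ConstSign g a b) :
    MonotoneOn f (Set.Icc a b) ∨ AntitoneOn f (Set.Icc a b) := by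
  have hc : ContinuousOn f (Set.Icc a b) := fun t ht => (h t ht).continuousAt.continuousWithinAt
  rcases hg with hg | hg
  · left
    refine monotoneOn_of_hasDerivWithinAt_nonneg (f' := g) (convex_Icc a b) hc ?_ ?_
    · intro t ht; exact (h t (interior_subset ht)).hasDerivWithinAt
    · intro t ht; exact hg t (interior_subset ht)
  · right
    refine antitoneOn_of_hasDerivWithinAt_nonpos (f' := g) (convex_Icc a b) hc ?_ ?_
    · intro t ht; exact (h t (interior_subset ht)).hasDerivWithinAt
    · intro t ht; exact hg t (interior_subset ht)

lemma MonotoneOn.exists_constSign_split {g : ℝ → ℝ} {a b : ℝ} (hab : a ≤ b)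
    (hc : ContinuousOn g (Set.Icc a b)) (hg : MonotoneOn g (Set.Icc a b)) :
    ∃ c ∈ Set.Icc a b, ConstSign g a c ∧ ConstSign g c b := by
  have ha : a ∈ Set.Icc a b := ⟨le_rfl, hab⟩
  have hb : b ∈ Set.Icc a b := ⟨hab, le_rfl⟩
  by_cases h1 : 0 ≤ g a
  · exact ⟨a, ha, Or.inl fun t ht => h1.trans (hg ha ⟨ht.1, ht.2.trans hab⟩ ht.1),
      Or.inl fun t ht => h1.trans (hg ha ht ht.1)⟩
  by_cases h2 : g b ≤ 0
  · exact ⟨b, hb, Or.inr fun t ht => (hg ht hb ht.2).trans h2,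
      Or.inr fun t ht => (hg ⟨hab.trans ht.1, ht.2⟩ hb ht.2).trans h2⟩
  push Not at h1 h2
  obtain ⟨c, hcm, hc0⟩ := intermediate_value_Icc hab hc ⟨h1.le, h2.le⟩
  refine ⟨c, hcm, Or.inr fun t ht => ?_, Or.inl fun t ht => ?_⟩
  · exact hc0 ▸ hg ⟨ht.1, ht.2.trans hcm.2⟩ hcm ht.2
  · exact hc0 ▸ hg hcm ⟨hcm.1.trans ht.1, ht.2⟩ ht.1

lemma ConstSign.neg {g : ℝ → ℝ} {a b : ℝ} (h : ConstSign (fun t => -g t) a b) :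
    ConstSign g a b := by
  rcases h with h | h
  · exact Or.inr fun t ht => neg_nonneg.1 (h t ht)
  · exact Or.inl fun t ht => neg_nonpos.1 (h t ht)

lemma exists_constSign_split {g : ℝ → ℝ} {a b : ℝ} (hab : a ≤ b)
    (hc : ContinuousOn g (Set.Icc a b))
    (hg : MonotoneOn g (Set.Icc a b) ∨ AntitoneOn g (Set.Icc a b)) :
    ∃ c ∈ Set.Icc a b, ConstSign g a c ∧ ConstSign g c b := by
  rcases hg with hg | hg
  · exact hg.exists_constSign_split hab hc
  · obtain ⟨c, h, h1, h2⟩ := MonotoneOn.exists_constSign_split hab hc.neg hg.neg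
    exact ⟨c, h, ConstSign.neg h1, ConstSign.neg h2⟩

/-- A measure bound on the intervals where `f 1` has constant sign propagates to intervals where
a higher derivative has constant sign. -/
lemma measure_Icc_le_of_constSign (μ : Measure ℝ) {K : ℝ≥0∞} {f : ℕ → ℝ → ℝ} (n : ℕ) {a b : ℝ}
    (hab : a ≤ b) (hf : DerivChain f (n + 1) a b) (hs : ConstSign (f (n + 1)) a b)
    (H : ∀ α β, a ≤ α → β ≤ b → α ≤ β → ConstSign (f 1) α β → μ (Set.Icc α β) ≤ K) :
    μ (Set.Icc a b) ≤ 2 ^ n * K := by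
  induction n generalizing a b with
  | zero => simpa using H a b le_rfl le_rfl hab hs
  | succ n ih =>
    have hm := monotoneOn_or_antitoneOn_of_constSign (hf (n + 1) (by omega)) hs
    obtain ⟨c, hc, h1, h2⟩ :=
      exists_constSign_split hab (hf.continuousOn (j := n + 1) (by omega)) hm
    have e1 := ih hc.1 (hf.mono (by omega) le_rfl hc.2) h1
      fun α β h h' h'' => H α β h (h'.trans hc.2) h''
    have e2 := ih hc.2 (hf.mono (by omega) hc.1 le_rfl) h2
      fun α β h h' h'' => H α β (hc.1.trans h) h' h''
    calc μ (Set.Icc a b) = μ (Set.Icc a c ∪ Set.Icc c b) := by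
          rw [Set.Icc_union_Icc_eq_Icc hc.1 hc.2]
      _ ≤ 2 ^ n * K + 2 ^ n * K := (measure_union_le _ _).trans (add_le_add e1 e2)
      _ = 2 ^ (n + 1) * K := by ring

/-- A function that is small on an interval whose length is large cannot have a large `k`-th
derivative. -/
lemma mul_pow_le_of_abs_le {f : ℕ → ℝ → ℝ} (k : ℕ) {α β c y τ : ℝ} (hτ : 0 ≤ τ)
    (hτβ : α + k * τ ≤ β) (hf : DerivChain f k α β) (hc : ∀ t ∈ Set.Icc α β, c ≤ f k t)
    (hy : ∀ t ∈ Set.Icc α β, |f 0 t| ≤ y) : c * τ ^ k ≤ 2 ^ k * y := by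
  induction k generalizing f β c y with
  | zero =>
    have hα : α ∈ Set.Icc α β := ⟨le_rfl, by simpa using hτβ⟩
    simpa using (hc α hα).trans ((le_abs_self _).trans (hy α hα))
  | succ k ih =>
    push_cast at hτβ
    have hsub : ∀ t ∈ Set.Icc α (β - τ), t ∈ Set.Icc α β ∧ t + τ ∈ Set.Icc α β :=
      fun t ht => ⟨⟨ht.1, by linarith [ht.2]⟩, by linarith [ht.1], by linarith [ht.2]⟩
    have := ih (f := fun j t => f j (t + τ) - f j t) (β := β - τ) (c := c * τ) (y := 2 * y)
      (by linarith) ?_ ?_ ?_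
    · calc c * τ ^ (k + 1) = c * τ * τ ^ k := by ring
        _ ≤ 2 ^ k * (2 * y) := this
        _ = _ := by ring
    · intro j hj t ht
      have h1 := hf j (by omega) t (hsub t ht).1
      have h2 := hf j (by omega) (t + τ) (hsub t ht).2
      exact (h2.comp_add_const t τ).sub h1
    · intro t ht
      rcases hτ.eq_or_lt with h0 | h0
      · simp [← h0]
      obtain ⟨ξ, hξ, h⟩ := exists_hasDerivAt_eq_slope (f k) (f (k + 1)) (a := t) (b := t + τ)
        (by linarith) ((hf.continuousOn (Nat.lt_succ_self k)).mono
          (Set.Icc_subset_Icc ht.1 (hsub t ht).2.2))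
        (fun x hx => hf k (Nat.lt_succ_self k) x ⟨ht.1.trans hx.1.le,
          hx.2.le.trans (hsub t ht).2.2⟩)
      have h3 := hc ξ ⟨ht.1.trans hξ.1.le, hξ.2.le.trans (hsub t ht).2.2⟩
      rw [h, le_div_iff₀ (by linarith)] at h3
      simpa using h3
    · intro t ht
      have h1 := hy t (hsub t ht).1
      have h2 := hy _ (hsub t ht).2
      exact (abs_sub _ _).trans (by linarith)

/-- `f 0` has a `k`-th derivative bounded away from zero by `c`, with constant sign. -/
def DerivLower (f : ℕ → ℝ → ℝ) (k : ℕ) (c a b : ℝ) : Prop :=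
  (∀ t ∈ Set.Icc a b, c ≤ f k t) ∨ (∀ t ∈ Set.Icc a b, f k t ≤ -c)

lemma DerivLower.constSign {f : ℕ → ℝ → ℝ} {k : ℕ} {c a b : ℝ} (h : DerivLower f k c a b)
    (hc : 0 ≤ c) : ConstSign (f k) a b := by
  rcases h with h | h
  · exact Or.inl fun t ht => hc.trans (h t ht)
  · exact Or.inr fun t ht => (h t ht).trans (by linarith)

lemma length_le_of_derivLower {f : ℕ → ℝ → ℝ} {k : ℕ} (hk : 1 ≤ k) {α β c y : ℝ} (hc : 0 < c)
    (hαβ : α ≤ β) (hf : DerivChain f k α β) (hl : DerivLower f k c α β)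
    (hy : ∀ t ∈ Set.Icc α β, |f 0 t| ≤ y) : β - α ≤ 2 * k * (y / c) ^ (1 / k : ℝ) := by
  have hk0 : (0 : ℝ) < k := by exact_mod_cast hk
  have hy0 : 0 ≤ y := (abs_nonneg _).trans (hy α ⟨le_rfl, hαβ⟩)
  set τ := (β - α) / k with hτ
  have hτ0 : 0 ≤ τ := div_nonneg (by linarith) hk0.le
  have hτβ : α + k * τ ≤ β := by rw [hτ, mul_div_cancel₀ _ hk0.ne']; linarith
  have key : c * τ ^ k ≤ 2 ^ k * y := by
    rcases hl with hl | hl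
    · exact mul_pow_le_of_abs_le k hτ0 hτβ hf hl hy
    · refine mul_pow_le_of_abs_le (f := fun j t => -f j t) k hτ0 hτβ
        (fun j hj t ht => (hf j hj t ht).neg) (fun t ht => by linarith [hl t ht]) ?_
      simpa using hy
  have h2 : (τ / 2) ^ k ≤ y / c := by
    rw [div_pow, div_le_div_iff₀ (by positivity) hc]; linarith
  have h3 : τ / 2 ≤ (y / c) ^ (1 / k : ℝ) := by
    rw [one_div, Real.le_rpow_inv_iff_of_pos (by positivity) (by positivity) hk0]
    exact_mod_cast h2
  have : β - α = τ * k := by rw [hτ]; field_simp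
  nlinarith

/-- Sublevel set estimate. -/
lemma volume_sublevel_le {f : ℕ → ℝ → ℝ} {k : ℕ} (hk : 1 ≤ k) {a b c y : ℝ} (hc : 0 < c)
    (hab : a ≤ b) (hf : DerivChain f k a b) (hl : DerivLower f k c a b) :
    volume {t ∈ Set.Icc a b | |f 0 t| ≤ y}
      ≤ 2 ^ (k - 1) * ENNReal.ofReal (2 * k * (y / c) ^ (1 / k : ℝ)) := by
  set S := {t ∈ Set.Icc a b | |f 0 t| ≤ y} with hS
  obtain ⟨n, rfl⟩ : ∃ n, k = n + 1 := ⟨k - 1, by omega⟩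
  have hmS : MeasurableSet S := by
    have h0 := hf.continuousOn (j := 0) (by omega)
    have : S = Set.Icc a b ∩ (fun t => |f 0 t|) ⁻¹' Set.Iic y := rfl
    rw [this]
    exact (h0.abs.preimage_isClosed_of_isClosed isClosed_Icc isClosed_Iic).measurableSet
  have := measure_Icc_le_of_constSign (volume.restrict S) n hab hf (hl.constSign hc.le)
    (K := ENNReal.ofReal (2 * (n + 1 : ℕ) * (y / c) ^ (1 / (n + 1 : ℕ) : ℝ))) ?_
  · rwa [Measure.restrict_apply measurableSet_Icc,
      Set.inter_eq_right.2 (Set.sep_subset _ _)] at this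
  intro α β hα hβ hαβ hs
  rw [Measure.restrict_apply measurableSet_Icc]
  have hm := monotoneOn_or_antitoneOn_of_constSign (f := f 0) (g := f 1) (a := α) (b := β)
    (fun t ht => hf 0 (by omega) t ⟨hα.trans ht.1, ht.2.trans hβ⟩) hs
  refine (Real.volume_le_diam _).trans ?_
  refine Metric.ediam_le fun t₁ h₁ t₂ h₂ => ?_
  wlog h12 : t₁ ≤ t₂ generalizing t₁ t₂
  · rw [edist_comm]; exact this t₂ h₂ t₁ h₁ (le_of_not_ge h12)
  rw [edist_dist, dist_comm, Real.dist_eq, abs_of_nonneg (by linarith)]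
  refine ENNReal.ofReal_le_ofReal ?_
  refine length_le_of_derivLower (by omega) hc h12 (hf.mono le_rfl (hα.trans h₁.1.1)
    (h₂.1.2.trans hβ)) ?_ ?_
  · exact hl.imp (fun h t ht => h t ⟨(hα.trans h₁.1.1).trans ht.1, ht.2.trans (h₂.1.2.trans hβ)⟩)
      (fun h t ht => h t ⟨(hα.trans h₁.1.1).trans ht.1, ht.2.trans (h₂.1.2.trans hβ)⟩)
  · intro t ht
    have htm : t ∈ Set.Icc α β := ⟨h₁.1.1.trans ht.1, ht.2.trans h₂.1.2⟩
    have b1 := abs_le.1 h₁.2.2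
    have b2 := abs_le.1 h₂.2.2
    rw [abs_le]
    rcases hm with hm | hm
    · have := hm h₁.1 htm ht.1
      have := hm htm h₂.1 ht.2
      constructor <;> linarith
    · have := hm h₁.1 htm ht.1
      have := hm htm h₂.1 ht.2
      constructor <;> linarith

lemma lintegral_inv_add_abs_le_of_sublevel {S : Set ℝ} (hS : MeasurableSet S) {h : ℝ → ℝ}
    (hh : AEMeasurable h (volume.restrict S)) {A θ M : ℝ} (hA : 0 ≤ A) (hθ0 : 0 < θ) (hθ : θ < 1)
    (hM : 0 < M) (H : ∀ y > 0, volume {t ∈ S | |h t| ≤ y} ≤ ENNReal.ofReal (A * y ^ θ)) :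
    ∫⁻ t in S, ENNReal.ofReal (1 / (M + |h t|))
      ≤ ENNReal.ofReal (A / (1 - θ) * M ^ (θ - 1)) := by
  rw [lintegral_eq_lintegral_meas_le _
    (Filter.Eventually.of_forall fun t => by positivity) (by
      have : AEMeasurable (fun t => |h t|) (volume.restrict S) := hh.norm
      fun_prop)]
  have hfint : IntervalIntegrable (fun t : ℝ => A * t ^ (-θ)) volume 0 (1 / M) :=
    (intervalIntegral.intervalIntegrable_rpow' (by linarith)).const_mul A
  have hval : ∫ t in (0 : ℝ)..(1 / M), A * t ^ (-θ) = A / (1 - θ) * M ^ (θ - 1) := by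
    rw [intervalIntegral.integral_const_mul, integral_rpow (Or.inl (by linarith)),
      Real.zero_rpow (by linarith), one_div, Real.inv_rpow hM.le, ← Real.rpow_neg hM.le]
    rw [show -(-θ + 1) = θ - 1 by ring, show -θ + 1 = 1 - θ by ring]
    ring
  have h0M : (0 : ℝ) ≤ 1 / M := by positivity
  calc ∫⁻ t in Set.Ioi (0 : ℝ), (volume.restrict S) {a | t ≤ 1 / (M + |h a|)}
      ≤ ∫⁻ t in Set.Ioi (0 : ℝ), (Set.Ioc 0 (1 / M)).indicator
          (fun t => ENNReal.ofReal (A * t ^ (-θ))) t := by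
        refine setLIntegral_mono' measurableSet_Ioi fun t (ht : 0 < t) => ?_
        rw [Measure.restrict_apply' hS]
        by_cases htM : t ≤ 1 / M
        · rw [Set.indicator_of_mem (show t ∈ Set.Ioc 0 (1 / M) from ⟨ht, htM⟩)]
          have hsub : {a | t ≤ 1 / (M + |h a|)} ∩ S ⊆ {a ∈ S | |h a| ≤ 1 / t} := by
            rintro a ⟨ha, haS⟩
            refine ⟨haS, ?_⟩
            have hp : 0 < M + |h a| := by positivity
            have ha' : t ≤ 1 / (M + |h a|) := ha
            rw [le_div_iff₀ hp] at ha'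
            rw [le_div_iff₀ ht]
            nlinarith [abs_nonneg (h a)]
          refine (measure_mono hsub).trans ((H (1 / t) (by positivity)).trans_eq ?_)
          rw [one_div, Real.inv_rpow ht.le, Real.rpow_neg ht.le]
        · rw [Set.indicator_of_notMem (fun h => htM h.2)]
          refine le_of_eq ?_
          convert measure_empty (μ := volume)
          rw [Set.eq_empty_iff_forall_notMem]
          rintro a ⟨ha, -⟩
          refine htM (le_trans ha ?_)
          exact one_div_le_one_div_of_le hM (by linarith [abs_nonneg (h a)])
    _ ≤ ∫⁻ t, (Set.Ioc 0 (1 / M)).indicator (fun t => ENNReal.ofReal (A * t ^ (-θ))) t :=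
        setLIntegral_le_lintegral _ _
    _ = ∫⁻ t in Set.Ioc 0 (1 / M), ENNReal.ofReal (A * t ^ (-θ)) :=
        lintegral_indicator measurableSet_Ioc _
    _ = ENNReal.ofReal (∫ t in Set.Ioc 0 (1 / M), A * t ^ (-θ)) := by
        rw [ofReal_integral_eq_lintegral_ofReal]
        · exact (intervalIntegrable_iff_integrableOn_Ioc_of_le h0M).1 hfint
        · refine (ae_restrict_iff' measurableSet_Ioc).2 (Filter.Eventually.of_forall fun t ht => ?_)
          exact mul_nonneg hA (Real.rpow_nonneg ht.1.le _)
    _ = _ := by rw [← hval, intervalIntegral.integral_of_le h0M]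

/-- One-dimensional singular integral bound for functions with a large `k`-th derivative. -/
lemma exists_lintegral_inv_add_abs_le {k : ℕ} (hk : 2 ≤ k) {c : ℝ} (hc : 0 < c) :
    ∃ K > 0, ∀ (f : ℕ → ℝ → ℝ) (a b M : ℝ), a ≤ b → 0 < M → DerivChain f k a b →
      DerivLower f k c a b → ∫⁻ t in Set.Icc a b, ENNReal.ofReal (1 / (M + |f 0 t|))
        ≤ ENNReal.ofReal (K * M ^ (1 / k - 1 : ℝ)) := by
  have hk0 : (2 : ℝ) ≤ k := by exact_mod_cast hk
  have hk1 : (1 / k : ℝ) < 1 := by rw [div_lt_one (by linarith)]; linarith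
  refine ⟨(2 ^ (k - 1) * (2 * k * (1 / c) ^ (1 / k : ℝ))) / (1 - 1 / k), ?_, ?_⟩
  · have : 0 < (1 - 1 / k : ℝ) := by linarith
    positivity
  intro f a b M hab hM hf hl
  refine lintegral_inv_add_abs_le_of_sublevel measurableSet_Icc
    ((hf.continuousOn (by omega)).aemeasurable measurableSet_Icc) (by positivity) (by positivity)
    hk1 hM fun y hy => (volume_sublevel_le (by omega) hc hab hf hl).trans_eq ?_
  rw [show (2 : ℝ≥0∞) ^ (k - 1) = ENNReal.ofReal (2 ^ (k - 1)) by
    rw [ENNReal.ofReal_pow (by norm_num)]; simp, ← ENNReal.ofReal_mul (by positivity)]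
  congr 1
  rw [div_eq_mul_one_div y c, Real.mul_rpow hy.le (by positivity)]
  ring

lemma exists_lintegral_inv_add_abs_le_of_first {c ℓ : ℝ} (hc : 0 < c) (hℓ : 0 < ℓ) :
    ∃ K > 0, ∀ (f : ℕ → ℝ → ℝ) (a b M : ℝ), a ≤ b → b - a ≤ ℓ → 0 < M → DerivChain f 1 a b →
      DerivLower f 1 c a b → ∫⁻ t in Set.Icc a b, ENNReal.ofReal (1 / (M + |f 0 t|))
        ≤ ENNReal.ofReal (K * M ^ (-(1 / 2) : ℝ)) := by
  refine ⟨√(ℓ * (2 * (1 / c))) / (1 - 1 / 2), by positivity, ?_⟩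
  intro f a b M hab hbℓ hM hf hl
  rw [show (-(1 / 2) : ℝ) = 1 / 2 - 1 by norm_num]
  refine lintegral_inv_add_abs_le_of_sublevel measurableSet_Icc
    ((hf.continuousOn (by omega)).aemeasurable measurableSet_Icc) (by positivity) (by positivity)
    (by norm_num) hM fun y hy => ?_
  have h1 : volume {t ∈ Set.Icc a b | |f 0 t| ≤ y} ≤ ENNReal.ofReal (2 * (y / c)) := by
    simpa using volume_sublevel_le (y := y) le_rfl hc hab hf hl
  have h2 : volume {t ∈ Set.Icc a b | |f 0 t| ≤ y} ≤ ENNReal.ofReal ℓ := by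
    refine (measure_mono (Set.sep_subset _ _)).trans ?_
    rw [Real.volume_Icc]
    exact ENNReal.ofReal_le_ofReal hbℓ
  have h3 : min (2 * (y / c)) ℓ ≤ √(ℓ * (2 * (1 / c))) * y ^ (1 / 2 : ℝ) := by
    rw [← Real.sqrt_eq_rpow, ← Real.sqrt_mul (by positivity)]
    have hyc : 0 < 2 * (y / c) := by positivity
    refine Real.le_sqrt_of_sq_le ?_
    have : ℓ * (2 * (1 / c)) * y = (2 * (y / c)) * ℓ := by ring
    rw [this, sq]
    exact mul_le_mul (min_le_left _ _) (min_le_right _ _) (le_min hyc.le hℓ.le) hyc.le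
  refine le_trans ?_ (ENNReal.ofReal_le_ofReal h3)
  rcases min_choice (2 * (y / c)) ℓ with h | h <;> rw [h] <;> assumption

lemma lintegral_abs_deriv_div_le {f : ℕ → ℝ → ℝ} {k : ℕ} (hk : 2 ≤ k) {a b c M : ℝ} (hc : 0 ≤ c)
    (hab : a ≤ b) (hM : 0 < M) (hf : DerivChain f k a b) (hl : DerivLower f k c a b) :
    ∫⁻ t in Set.Icc a b, ENNReal.ofReal (|f 1 t| / (M ^ 2 + f 0 t ^ 2))
      ≤ 2 ^ (k - 1) * ENNReal.ofReal (π / M) := by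
  obtain ⟨n, rfl⟩ : ∃ n, k = n + 1 := ⟨k - 1, by omega⟩
  have hcont : ContinuousOn (fun t => f 1 t / (M ^ 2 + f 0 t ^ 2)) (Set.Icc a b) := by
    have h0 := hf.continuousOn (j := 0) (by omega)
    have h1 := hf.continuousOn (j := 1) (by omega)
    exact h1.div (continuousOn_const.add (h0.pow 2)) fun t _ => by positivity
  have key := measure_Icc_le_of_constSign
    ((volume.restrict (Set.Icc a b)).withDensity
      fun t => ENNReal.ofReal (|f 1 t| / (M ^ 2 + f 0 t ^ 2))) n hab hf
    (hl.constSign hc) (K := ENNReal.ofReal (π / M)) ?_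
  · rwa [withDensity_apply _ measurableSet_Icc, Measure.restrict_restrict measurableSet_Icc,
      Set.inter_self] at key
  intro α β hα hβ hαβ hs
  have hsub : Set.Icc α β ⊆ Set.Icc a b := Set.Icc_subset_Icc hα hβ
  rw [withDensity_apply _ measurableSet_Icc, Measure.restrict_restrict measurableSet_Icc,
    Set.inter_eq_left.2 hsub]
  have hcont' := hcont.mono hsub
  have hprim : ∀ t ∈ Set.uIcc α β, HasDerivAt (fun t => arctan (f 0 t / M) / M)
      (f 1 t / (M ^ 2 + f 0 t ^ 2)) t := by
    intro t ht
    rw [Set.uIcc_of_le hαβ] at ht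
    refine (((hf 0 (by omega) t (hsub ht)).div_const M).arctan.div_const M).congr_deriv ?_
    have h1 : M ^ 2 + f 0 t ^ 2 ≠ 0 := by positivity
    have h2 : 1 + (f 0 t / M) ^ 2 ≠ 0 := by positivity
    rw [zero_add]
    field_simp
  have hFTC := intervalIntegral.integral_eq_sub_of_hasDerivAt hprim
    (hcont'.intervalIntegrable_of_Icc hαβ)
  have hbd : |∫ t in α..β, f 1 t / (M ^ 2 + f 0 t ^ 2)| ≤ π / M := by
    rw [hFTC, ← sub_div, abs_div, abs_of_pos hM]
    gcongr
    rw [abs_le]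
    have := arctan_lt_pi_div_two (f 0 α / M)
    have := arctan_lt_pi_div_two (f 0 β / M)
    have := neg_pi_div_two_lt_arctan (f 0 α / M)
    have := neg_pi_div_two_lt_arctan (f 0 β / M)
    constructor <;> linarith
  have hden : ∀ t, 0 < M ^ 2 + f 0 t ^ 2 := fun t => by positivity
  have habs : ∫ t in α..β, |f 1 t| / (M ^ 2 + f 0 t ^ 2)
      = |∫ t in α..β, f 1 t / (M ^ 2 + f 0 t ^ 2)| := by
    rcases hs with hs | hs
    · rw [abs_of_nonneg (intervalIntegral.integral_nonneg hαβ fun t ht =>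
        div_nonneg (hs t ht) (hden t).le)]
      refine intervalIntegral.integral_congr fun t ht => ?_
      rw [Set.uIcc_of_le hαβ] at ht
      simp only [abs_of_nonneg (hs t ht)]
    · have h1 : ∫ t in α..β, |f 1 t| / (M ^ 2 + f 0 t ^ 2)
          = -∫ t in α..β, f 1 t / (M ^ 2 + f 0 t ^ 2) := by
        rw [← intervalIntegral.integral_neg]
        refine intervalIntegral.integral_congr fun t ht => ?_
        rw [Set.uIcc_of_le hαβ] at ht
        simp only [abs_of_nonpos (hs t ht), neg_div]
      have h2 : 0 ≤ ∫ t in α..β, |f 1 t| / (M ^ 2 + f 0 t ^ 2) :=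
        intervalIntegral.integral_nonneg hαβ fun t _ => by have := hden t; positivity
      rw [h1] at h2 ⊢
      rw [abs_of_nonpos (by linarith)]
  have hfint : IntegrableOn (fun t => |f 1 t| / (M ^ 2 + f 0 t ^ 2)) (Set.Icc α β) := by
    have : ContinuousOn (fun t => |f 1 t / (M ^ 2 + f 0 t ^ 2)|) (Set.Icc α β) := hcont'.abs
    refine (this.congr fun t _ => ?_).integrableOn_Icc
    rw [abs_div, abs_of_pos (hden t)]
  rw [← ofReal_integral_eq_lintegral_ofReal hfint
    (Filter.Eventually.of_forall fun t => by have := hden t; positivity),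
    integral_Icc_eq_integral_Ioc, ← intervalIntegral.integral_of_le hαβ, habs]
  exact ENNReal.ofReal_le_ofReal hbd

/-- Smoothness at a point of the plane. -/
abbrev SmoothAt (f : ℝ × ℝ → ℝ) (z : ℝ × ℝ) : Prop := ContDiffAt ℝ (⊤ : ℕ∞) f z

/-- Partial derivative in the first variable. -/
def dx (f : ℝ × ℝ → ℝ) (z : ℝ × ℝ) : ℝ := fderiv ℝ f z (1, 0)

/-- Partial derivative in the second variable. -/
def dy (f : ℝ × ℝ → ℝ) (z : ℝ × ℝ) : ℝ := fderiv ℝ f z (0, 1)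

lemma SmoothAt.differentiableAt {f : ℝ × ℝ → ℝ} {z : ℝ × ℝ} (h : SmoothAt f z) :
    DifferentiableAt ℝ f z := ContDiffAt.differentiableAt h (by simp)

lemma SmoothAt.hasFDerivAt {f : ℝ × ℝ → ℝ} {z : ℝ × ℝ} (h : SmoothAt f z) :
    HasFDerivAt f (fderiv ℝ f z) z := h.differentiableAt.hasFDerivAt

lemma SmoothAt.fderiv {f : ℝ × ℝ → ℝ} {z : ℝ × ℝ} (h : SmoothAt f z) :
    ContDiffAt ℝ (⊤ : ℕ∞) (fderiv ℝ f) z :=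
  ContDiffAt.fderiv_right h (by exact_mod_cast le_top)

lemma SmoothAt.dx {f : ℝ × ℝ → ℝ} {z : ℝ × ℝ} (h : SmoothAt f z) : SmoothAt (dx f) z :=
  h.fderiv.clm_apply contDiffAt_const

lemma SmoothAt.dy {f : ℝ × ℝ → ℝ} {z : ℝ × ℝ} (h : SmoothAt f z) : SmoothAt (dy f) z :=
  h.fderiv.clm_apply contDiffAt_const

lemma fderiv_apply_eq (f : ℝ × ℝ → ℝ) (z w : ℝ × ℝ) :
    fderiv ℝ f z w = w.1 * dx f z + w.2 * dy f z := by
  have : w = w.1 • ((1 : ℝ), (0 : ℝ)) + w.2 • ((0 : ℝ), (1 : ℝ)) := by ext <;> simp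
  conv_lhs => rw [this]
  rw [map_add, map_smul, map_smul]
  rfl

lemma SmoothAt.hasDerivAt_fst {f : ℝ × ℝ → ℝ} {x y : ℝ} (h : SmoothAt f (x, y)) :
    HasDerivAt (fun x => f (x, y)) (_root_.dx f (x, y)) x :=
  h.hasFDerivAt.comp_hasDerivAt x ((hasDerivAt_id x).prodMk (hasDerivAt_const x y))

lemma SmoothAt.hasDerivAt_snd {f : ℝ × ℝ → ℝ} {x y : ℝ} (h : SmoothAt f (x, y)) :
    HasDerivAt (fun y => f (x, y)) (_root_.dy f (x, y)) y :=
  h.hasFDerivAt.comp_hasDerivAt y ((hasDerivAt_const y x).prodMk (hasDerivAt_id y))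

/-- The oscillating factor `e^{iλΦ}`. -/
def osc (lam : ℝ) (Φ : ℝ × ℝ → ℝ) (z : ℝ × ℝ) : ℂ :=
  Complex.exp (Complex.I * ((lam * Φ z : ℝ) : ℂ))

lemma norm_osc (lam : ℝ) (Φ : ℝ × ℝ → ℝ) (z : ℝ × ℝ) : ‖osc lam Φ z‖ = 1 := by
  rw [osc, mul_comm, Complex.norm_exp_ofReal_mul_I]

lemma SmoothAt.hasFDerivAt_osc {Φ : ℝ × ℝ → ℝ} {z : ℝ × ℝ} (h : SmoothAt Φ z) (lam : ℝ) :
    HasFDerivAt (osc lam Φ) (osc lam Φ z • (Complex.I • Complex.ofRealCLM.comp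
      (lam • _root_.fderiv ℝ Φ z))) z := by
  have h1 : HasFDerivAt (fun z => ((lam * Φ z : ℝ) : ℂ))
      (Complex.ofRealCLM.comp (lam • _root_.fderiv ℝ Φ z)) z :=
    Complex.ofRealCLM.hasFDerivAt.comp z (h.hasFDerivAt.const_mul lam)
  exact (h1.const_mul Complex.I).cexp

lemma SmoothAt.hasFDerivAt_smul_osc {A Φ : ℝ × ℝ → ℝ} {z : ℝ × ℝ} (hA : SmoothAt A z)
    (h : SmoothAt Φ z) (lam : ℝ) :
    HasFDerivAt (fun z => A z • osc lam Φ z) (A z • (osc lam Φ z • (Complex.I •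
      Complex.ofRealCLM.comp (lam • _root_.fderiv ℝ Φ z)))
        + (_root_.fderiv ℝ A z).smulRight (osc lam Φ z)) z :=
  hA.hasFDerivAt.smul (h.hasFDerivAt_osc lam)

lemma enorm_intervalIntegral_smul_osc_le {a b : ℝ} (hab : a ≤ b) (A : ℝ → ℝ) (e : ℝ → ℂ)
    (he : ∀ t, ‖e t‖ = 1) :
    ‖∫ t in a..b, A t • e t‖ₑ ≤ ∫⁻ t in Set.Icc a b, ENNReal.ofReal |A t| := by
  rw [intervalIntegral.integral_of_le hab, ← integral_Icc_eq_integral_Ioc]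
  refine (enorm_integral_le_lintegral_enorm _).trans_eq (lintegral_congr fun t => ?_)
  rw [← ofReal_norm, norm_smul, he, mul_one, Real.norm_eq_abs]

/-- Integration by parts along the vector field `(A, B)` on a rectangle. -/
lemma ofReal_mul_norm_setIntegral_osc_le {Φ A B : ℝ × ℝ → ℝ} {a b : ℝ × ℝ} (hab : a ≤ b)
    {lam : ℝ} (hlam : 0 ≤ lam)
    (hΦ : ∀ z ∈ Set.Icc a b, SmoothAt Φ z) (hA : ∀ z ∈ Set.Icc a b, SmoothAt A z)
    (hB : ∀ z ∈ Set.Icc a b, SmoothAt B z) :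
    ENNReal.ofReal (lam * ‖∫ z in Set.Icc a b, osc lam Φ z‖) ≤
      (∫⁻ z in Set.Icc a b, ENNReal.ofReal (lam * |1 - (A z * dx Φ z + B z * dy Φ z)|
          + |dx A z + dy B z|))
      + (∫⁻ x in Set.Icc a.1 b.1, ENNReal.ofReal |B (x, b.2)|)
      + (∫⁻ x in Set.Icc a.1 b.1, ENNReal.ofReal |B (x, a.2)|)
      + (∫⁻ y in Set.Icc a.2 b.2, ENNReal.ofReal |A (b.1, y)|)
      + ∫⁻ y in Set.Icc a.2 b.2, ENNReal.ofReal |A (a.1, y)| := by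
  set e := osc lam Φ with he
  set D : ℝ × ℝ → ℂ := fun z => (((dx A z + dy B z : ℝ) : ℂ)
    + Complex.I * ((lam * (A z * dx Φ z + B z * dy Φ z) : ℝ) : ℂ)) * e z with hD
  have hcΦ : ∀ {F : ℝ × ℝ → ℝ}, (∀ z ∈ Set.Icc a b, SmoothAt F z) →
      ContinuousOn F (Set.Icc a b) := fun h z hz => (h z hz).continuousAt.continuousWithinAt
  have hce : ContinuousOn e (Set.Icc a b) := fun z hz =>
    ((hΦ z hz).hasFDerivAt_osc lam).continuousAt.continuousWithinAt
  have hcA := hcΦ hA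
  have hcB := hcΦ hB
  have hcAx := hcΦ fun z hz => (hA z hz).dx
  have hcBy := hcΦ fun z hz => (hB z hz).dy
  have hcx := hcΦ fun z hz => (hΦ z hz).dx
  have hcy := hcΦ fun z hz => (hΦ z hz).dy
  have hcD : ContinuousOn D (Set.Icc a b) := by
    refine ContinuousOn.mul (ContinuousOn.add ?_ (continuousOn_const.mul ?_)) hce
    · exact Complex.continuous_ofReal.comp_continuousOn (hcAx.add hcBy)
    · exact Complex.continuous_ofReal.comp_continuousOn
        (continuousOn_const.mul ((hcA.mul hcx).add (hcB.mul hcy)))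
  have hDi : IntegrableOn D (Set.Icc a b) := hcD.integrableOn_compact isCompact_Icc
  have hei : IntegrableOn e (Set.Icc a b) := hce.integrableOn_compact isCompact_Icc
  have hDeq : ∀ z, (A z • (osc lam Φ z • (Complex.I •
      Complex.ofRealCLM.comp (lam • fderiv ℝ Φ z)))
        + (fderiv ℝ A z).smulRight (osc lam Φ z)) (1, 0) + (B z • (osc lam Φ z • (Complex.I •
      Complex.ofRealCLM.comp (lam • fderiv ℝ Φ z)))
        + (fderiv ℝ B z).smulRight (osc lam Φ z)) (0, 1) = D z := by
    intro z
    simp only [hD, he, add_apply, smul_apply,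
      ContinuousLinearMap.smulRight_apply, ContinuousLinearMap.comp_apply,
      Complex.ofRealCLM_apply, Complex.real_smul, smul_eq_mul, dx, dy]
    push_cast
    ring
  have hdiv := integral_divergence_prod_Icc_of_hasFDerivAt_off_countable_of_le
    (fun z => A z • e z) (fun z => B z • e z) _ _ a b hab ∅ Set.countable_empty
    (hcA.smul hce) (hcB.smul hce)
    (fun z hz => (hA z ?_).hasFDerivAt_smul_osc (hΦ z ?_) lam)
    (fun z hz => (hB z ?_).hasFDerivAt_smul_osc (hΦ z ?_) lam)
    (by simpa only [hDeq] using hDi)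
  rotate_left
  iterate 4
    exact ⟨⟨hz.1.1.1.le, hz.1.2.1.le⟩, ⟨hz.1.1.2.le, hz.1.2.2.le⟩⟩
  simp only [hDeq] at hdiv
  have hsplit : Complex.I * (lam : ℂ) * ∫ z in Set.Icc a b, e z
      = (∫ z in Set.Icc a b, (Complex.I * (lam : ℂ) * e z - D z)) + ∫ z in Set.Icc a b, D z := by
    rw [integral_sub (hei.const_mul _) hDi, integral_const_mul]
    ring
  have hnorm : ENNReal.ofReal (lam * ‖∫ z in Set.Icc a b, e z‖)
      = ‖Complex.I * (lam : ℂ) * ∫ z in Set.Icc a b, e z‖ₑ := by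
    rw [← ofReal_norm, norm_mul, norm_mul, Complex.norm_I, one_mul, Complex.norm_real,
      Real.norm_of_nonneg hlam]
  rw [hnorm, hsplit, hdiv]
  have hmain : ‖∫ z in Set.Icc a b, (Complex.I * (lam : ℂ) * e z - D z)‖ₑ ≤
      ∫⁻ z in Set.Icc a b, ENNReal.ofReal (lam * |1 - (A z * dx Φ z + B z * dy Φ z)|
          + |dx A z + dy B z|) := by
    refine (enorm_integral_le_lintegral_enorm _).trans (lintegral_mono fun z => ?_)
    rw [← ofReal_norm]
    refine ENNReal.ofReal_le_ofReal ?_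
    have : Complex.I * (lam : ℂ) * e z - D z
        = (Complex.I * ((lam * (1 - (A z * dx Φ z + B z * dy Φ z)) : ℝ) : ℂ)
          - ((dx A z + dy B z : ℝ) : ℂ)) * e z := by
      simp only [hD]; push_cast; ring
    rw [this, norm_mul, norm_osc, mul_one]
    refine (norm_sub_le _ _).trans ?_
    rw [norm_mul, Complex.norm_I, one_mul, Complex.norm_real, Complex.norm_real,
      Real.norm_eq_abs, Real.norm_eq_abs, abs_mul, abs_of_nonneg hlam]
  have hb1 := enorm_intervalIntegral_smul_osc_le hab.1 (fun x => B (x, b.2)) (fun x => e (x, b.2))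
    fun _ => norm_osc _ _ _
  have hb2 := enorm_intervalIntegral_smul_osc_le hab.1 (fun x => B (x, a.2)) (fun x => e (x, a.2))
    fun _ => norm_osc _ _ _
  have hb3 := enorm_intervalIntegral_smul_osc_le hab.2 (fun y => A (b.1, y)) (fun y => e (b.1, y))
    fun _ => norm_osc _ _ _
  have hb4 := enorm_intervalIntegral_smul_osc_le hab.2 (fun y => A (a.1, y)) (fun y => e (a.1, y))
    fun _ => norm_osc _ _ _
  refine (enorm_add_le _ _).trans ?_
  simp only [add_assoc]
  refine add_le_add hmain ?_
  refine (enorm_sub_le).trans ?_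
  rw [← add_assoc, ← add_assoc]
  refine add_le_add ?_ hb4
  refine (enorm_add_le _ _).trans (add_le_add ?_ hb3)
  exact enorm_sub_le.trans (add_le_add hb1 hb2)

/-- The Jacobian determinant of `(p, τ)`. -/
def jac (p τ : ℝ × ℝ → ℝ) (z : ℝ × ℝ) : ℝ := dx p z * dy τ z - dy p z * dx τ z

/-- Derivation along the level curves of `p`, normalised so that `τ` has derivative one. -/
def levelDeriv (p τ f : ℝ × ℝ → ℝ) (z : ℝ × ℝ) : ℝ := jac p f z / jac p τ z

lemma SmoothAt.jac {p τ : ℝ × ℝ → ℝ} {z : ℝ × ℝ} (hp : SmoothAt p z) (hτ : SmoothAt τ z) :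
    SmoothAt (jac p τ) z := (hp.dx.mul hτ.dy).sub (hp.dy.mul hτ.dx)

lemma SmoothAt.levelDeriv {p τ f : ℝ × ℝ → ℝ} {z : ℝ × ℝ} (hp : SmoothAt p z) (hτ : SmoothAt τ z)
    (hf : SmoothAt f z) (hJ : _root_.jac p τ z ≠ 0) : SmoothAt (levelDeriv p τ f) z :=
  (hp.jac hf).div (hp.jac hτ) hJ

/-- A local chart given by the coordinates `(p, τ)`. -/
structure LevelChart (p τ : ℝ × ℝ → ℝ) (z₀ : ℝ × ℝ) (O : Set (ℝ × ℝ)) where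
  χ : ℝ × ℝ → ℝ × ℝ
  U : Set (ℝ × ℝ)
  r : ℝ
  C : ℝ
  isOpen : IsOpen U
  U_mem : U ∈ nhds z₀
  r_pos : 0 < r
  C_pos : 0 < C
  mem_O : ∀ ζ ∈ Metric.closedBall (p z₀, τ z₀) r, χ ζ ∈ O
  contDiffAt : ∀ ζ ∈ Metric.closedBall (p z₀, τ z₀) r, ContDiffAt ℝ 1 χ ζ
  rightInv : ∀ ζ ∈ Metric.closedBall (p z₀, τ z₀) r,
    ∀ᶠ ζ' in nhds ζ, (p (χ ζ'), τ (χ ζ')) = ζ'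
  leftInv : ∀ z ∈ U, χ (p z, τ z) = z
  lintegral_le : ∀ F : ℝ × ℝ → ℝ≥0∞, ∫⁻ z in U, F (p z, τ z)
    ≤ ENNReal.ofReal C * ∫⁻ ζ in Metric.closedBall (p z₀, τ z₀) r, F ζ

lemma prod_fderiv_det_ne_zero {p τ : ℝ × ℝ → ℝ} {z : ℝ × ℝ} (hJ : jac p τ z ≠ 0) :
    ((fderiv ℝ p z).prod (fderiv ℝ τ z)).det ≠ 0 := by
  intro h
  obtain ⟨w, hw, hw0⟩ := (Submodule.ne_bot_iff _).1 (LinearMap.bot_lt_ker_of_det_eq_zero h).ne'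
  have h1 : fderiv ℝ p z w = 0 := congrArg Prod.fst hw
  have h2 : fderiv ℝ τ z w = 0 := congrArg Prod.snd hw
  rw [fderiv_apply_eq] at h1 h2
  have e1 : w.1 * jac p τ z = 0 := by
    unfold jac; linear_combination dy τ z * h1 - dy p z * h2
  have e2 : w.2 * jac p τ z = 0 := by
    unfold jac; linear_combination dx p z * h2 - dx τ z * h1
  exact hw0 (Prod.ext ((mul_eq_zero.1 e1).resolve_right hJ) ((mul_eq_zero.1 e2).resolve_right hJ))

lemma nonempty_levelChart {p τ : ℝ × ℝ → ℝ} {z₀ : ℝ × ℝ} {O : Set (ℝ × ℝ)} (hO : O ∈ nhds z₀)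
    (hp : ∀ z ∈ O, SmoothAt p z) (hτ : ∀ z ∈ O, SmoothAt τ z) (hJ : jac p τ z₀ ≠ 0) :
    Nonempty (LevelChart p τ z₀ O) := by
  have hz₀ : z₀ ∈ O := mem_of_mem_nhds hO
  set Ψ : ℝ × ℝ → ℝ × ℝ := fun z => (p z, τ z) with hΨ
  have hΨd : ∀ z ∈ O, HasFDerivAt Ψ ((fderiv ℝ p z).prod (fderiv ℝ τ z)) z := fun z hz =>
    (hp z hz).hasFDerivAt.prodMk (hτ z hz).hasFDerivAt
  have hdet := prod_fderiv_det_ne_zero hJ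
  set L := ((fderiv ℝ p z₀).prod (fderiv ℝ τ z₀)) with hL
  set L' := L.toContinuousLinearEquivOfDetNeZero hdet with hL'
  have hΨs : ContDiffAt ℝ 1 Ψ z₀ :=
    ((hp z₀ hz₀).prodMk (hτ z₀ hz₀)).of_le (by exact_mod_cast le_top)
  have hΨ₀ : HasFDerivAt Ψ (L' : ℝ × ℝ →L[ℝ] ℝ × ℝ) z₀ := by
    rw [hL', ContinuousLinearMap.coe_toContinuousLinearEquivOfDetNeZero]; exact hΨd z₀ hz₀
  set e := hΨs.toOpenPartialHomeomorph Ψ hΨ₀ one_ne_zero with he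
  have hecoe : (e : ℝ × ℝ → ℝ × ℝ) = Ψ := rfl
  have hsrc : z₀ ∈ e.source := hΨs.mem_toOpenPartialHomeomorph_source hΨ₀ one_ne_zero
  have htgt : Ψ z₀ ∈ e.target := e.map_source hsrc
  have hinv : e.symm (Ψ z₀) = z₀ := e.left_inv hsrc
  have hsymm : ContDiffAt ℝ 1 e.symm (Ψ z₀) := hΨs.to_localInverse hΨ₀ one_ne_zero
  have hev : ∀ᶠ ζ in nhds (Ψ z₀), ζ ∈ e.target ∧ e.symm ζ ∈ O ∧ ContDiffAt ℝ 1 e.symm ζ := by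
    refine Filter.Eventually.and (e.open_target.mem_nhds htgt) (Filter.Eventually.and ?_ ?_)
    · exact hsymm.continuousAt.preimage_mem_nhds (by rwa [hinv])
    · exact hsymm.eventually (by simp)
  obtain ⟨r, hr, hball⟩ := Metric.nhds_basis_closedBall.eventually_iff.1 hev
  have hdetc : ContinuousAt (fun z => |((fderiv ℝ p z).prod (fderiv ℝ τ z)).det|) z₀ := by
    refine ContinuousAt.abs (ContinuousLinearMap.continuous_det.continuousAt.comp ?_)
    have h1 := (hp z₀ hz₀).fderiv.continuousAt
    have h2 := (hτ z₀ hz₀).fderiv.continuousAt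
    exact (ContinuousLinearMap.prodₗᵢ (𝕜 := ℝ) (E := ℝ × ℝ) (F := ℝ) (G := ℝ)
      ℝ).continuous.continuousAt.comp (h1.prodMk h2)
  have hd0 : 0 < |L.det| := abs_pos.2 hdet
  have hdev : ∀ᶠ z in nhds z₀, |L.det| / 2 < |((fderiv ℝ p z).prod (fderiv ℝ τ z)).det| :=
    hdetc.eventually (lt_mem_nhds (by change |L.det| / 2 < |L.det|; linarith))
  have hUev : ∀ᶠ z in nhds z₀, z ∈ O ∧ z ∈ e.source ∧ Ψ z ∈ Metric.closedBall (Ψ z₀) r ∧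
      |L.det| / 2 < |((fderiv ℝ p z).prod (fderiv ℝ τ z)).det| := by
    filter_upwards [hO, e.open_source.mem_nhds hsrc, hdev,
      hΨ₀.continuousAt.preimage_mem_nhds (Metric.closedBall_mem_nhds _ hr)] with z h1 h2 h3 h4
    exact ⟨h1, h2, h4, h3⟩
  obtain ⟨U, hU, hUo, hzU⟩ := eventually_nhds_iff.1 hUev
  refine ⟨⟨e.symm, U, r, 2 / |L.det|, hUo, hUo.mem_nhds hzU, hr, by positivity,
    fun ζ hζ => (hball hζ).2.1, fun ζ hζ => (hball hζ).2.2, fun ζ hζ => ?_, fun z hz => ?_, ?_⟩⟩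
  · filter_upwards [e.open_target.mem_nhds (hball hζ).1] with ζ' hζ'
    exact e.right_inv hζ'
  · exact e.left_inv (hU z hz).2.1
  · intro F
    have hinj : Set.InjOn Ψ U := fun a ha b hb hab =>
      e.injOn (hU a ha).2.1 (hU b hb).2.1 hab
    have hcv := lintegral_image_eq_lintegral_abs_det_fderiv_mul volume hUo.measurableSet
      (fun z hz => (hΨd z (hU z hz).1).hasFDerivWithinAt) hinj F
    have him : Ψ '' U ⊆ Metric.closedBall (Ψ z₀) r := by
      rintro _ ⟨z, hz, rfl⟩; exact (hU z hz).2.2.1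
    calc ∫⁻ z in U, F (Ψ z)
        ≤ ∫⁻ z in U, ENNReal.ofReal (2 / |L.det|) *
            (ENNReal.ofReal |((fderiv ℝ p z).prod (fderiv ℝ τ z)).det| * F (Ψ z)) := by
          refine setLIntegral_mono' hUo.measurableSet fun z hz => ?_
          rw [← mul_assoc, ← ENNReal.ofReal_mul (by positivity)]
          refine le_mul_of_one_le_left zero_le ?_
          rw [ENNReal.one_le_ofReal, div_mul_eq_mul_div, le_div_iff₀ hd0]
          linarith [(hU z hz).2.2.2]
      _ = ENNReal.ofReal (2 / |L.det|) * ∫⁻ ζ in Ψ '' U, F ζ := by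
          rw [lintegral_const_mul' _ _ ENNReal.ofReal_ne_top, hcv]
      _ ≤ _ := by gcongr

lemma LevelChart.hasDerivAt {p τ f : ℝ × ℝ → ℝ} {z₀ : ℝ × ℝ} {O : Set (ℝ × ℝ)}
    (c : LevelChart p τ z₀ O) (hp : ∀ z ∈ O, SmoothAt p z) (hτ : ∀ z ∈ O, SmoothAt τ z)
    (hf : ∀ z ∈ O, SmoothAt f z) (hJ : ∀ z ∈ O, jac p τ z ≠ 0) {w t : ℝ}
    (h : (w, t) ∈ Metric.closedBall (p z₀, τ z₀) c.r) :
    HasDerivAt (fun t => f (c.χ (w, t))) (levelDeriv p τ f (c.χ (w, t))) t := by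
  have hO := c.mem_O _ h
  have hχ : HasDerivAt (fun t => c.χ (w, t)) (fderiv ℝ c.χ (w, t) (0, 1)) t :=
    ((c.contDiffAt _ h).differentiableAt one_ne_zero).hasFDerivAt.comp_hasDerivAt t
      ((hasDerivAt_const t w).prodMk (hasDerivAt_id t))
  set u := fderiv ℝ c.χ (w, t) (0, 1) with hu
  have hcomp : ∀ {g : ℝ × ℝ → ℝ}, (∀ z ∈ O, SmoothAt g z) →
      HasDerivAt (fun t => g (c.χ (w, t))) (u.1 * dx g (c.χ (w, t))
        + u.2 * dy g (c.χ (w, t))) t := by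
    intro g hg
    rw [← fderiv_apply_eq]
    exact (hg _ hO).hasFDerivAt.comp_hasDerivAt t hχ
  have hline : Filter.Tendsto (fun t' : ℝ => (w, t')) (nhds t) (nhds (w, t)) :=
    (Continuous.prodMk_right w).tendsto t
  have hr := hline.eventually (c.rightInv _ h)
  have e1 := (hcomp hp).unique ((hasDerivAt_const t w).congr_of_eventuallyEq
    (hr.mono fun t' ht' => congrArg Prod.fst ht'))
  have e2 := (hcomp hτ).unique ((hasDerivAt_id t).congr_of_eventuallyEq
    (hr.mono fun t' ht' => congrArg Prod.snd ht'))
  refine (hcomp hf).congr_deriv ?_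
  rw [levelDeriv, eq_div_iff (hJ _ hO)]
  unfold jac
  set z := c.χ (w, t)
  linear_combination (dx f z * dy τ z - dy f z * dx τ z) * e1
    + (dx p z * dy f z - dy p z * dx f z) * e2

lemma lintegral_comp_sub_div (F : ℝ → ℝ≥0∞) (σ : ℝ) {δ : ℝ} (hδ : 0 < δ) :
    ∫⁻ w, F ((w - σ) / δ) = ENNReal.ofReal δ * ∫⁻ u, F u := by
  have h := lintegral_image_eq_lintegral_abs_deriv_mul (s := Set.univ)
    (f := fun w => (w - σ) / δ) (f' := fun _ => 1 / δ) MeasurableSet.univ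
    (fun w _ => (((hasDerivAt_id w).sub_const σ).div_const δ).hasDerivWithinAt)
    (fun a _ b _ hab => by
      have := (div_left_inj' hδ.ne').1 hab
      linarith) F
  have himg : (fun w => (w - σ) / δ) '' Set.univ = Set.univ := by
    rw [Set.image_univ, Set.range_eq_univ]
    exact fun u => ⟨u * δ + σ, by field_simp; ring⟩
  rw [himg, Measure.restrict_univ, lintegral_const_mul' _ _ ENNReal.ofReal_ne_top] at h
  rw [h, ← mul_assoc, ← ENNReal.ofReal_mul hδ.le, abs_of_pos (by positivity),
    mul_one_div_cancel hδ.ne', ENNReal.ofReal_one, one_mul]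

lemma exists_lintegral_one_add_abs_rpow_le {r : ℝ} (hr : 1 < r) :
    ∃ K > 0, ∀ (σ δ : ℝ), 0 < δ →
      ∫⁻ w, ENNReal.ofReal ((1 + |(w - σ) / δ|) ^ (-r)) ≤ ENNReal.ofReal (K * δ) := by
  have hfin : (∫⁻ x : ℝ, ENNReal.ofReal ((1 + ‖x‖) ^ (-r))) < ∞ :=
    finite_integral_one_add_norm (μ := volume) (by simpa using hr)
  refine ⟨(∫⁻ x : ℝ, ENNReal.ofReal ((1 + ‖x‖) ^ (-r))).toReal + 1, by positivity,
    fun σ δ hδ => ?_⟩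
  rw [lintegral_comp_sub_div (fun u => ENNReal.ofReal ((1 + |u|) ^ (-r))) σ hδ, mul_comm _ δ,
    ENNReal.ofReal_mul hδ.le]
  gcongr
  refine (ENNReal.le_ofReal_iff_toReal_le hfin.ne (by positivity)).2 ?_
  exact (lt_add_one _).le

lemma lintegral_comp_le_of_derivLower {f : ℕ → ℝ → ℝ} {c a b : ℝ} (hc : 0 < c)
    (hf : DerivChain f 1 a b) (hl : DerivLower f 1 c a b) (F : ℝ → ℝ≥0∞) :
    ∫⁻ t in Set.Icc a b, F (f 0 t) ≤ ENNReal.ofReal (1 / c) * ∫⁻ u, F u := by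
  have hcont := hf.continuousOn (j := 0) one_pos
  have hd : ∀ t ∈ Set.Icc a b, HasDerivAt (f 0) (f 1 t) t := hf 0 one_pos
  have hinj : Set.InjOn (f 0) (Set.Icc a b) := by
    rcases hl with hl | hl
    · refine (strictMonoOn_of_deriv_pos (convex_Icc a b) hcont fun t ht => ?_).injOn
      rw [(hd t (interior_subset ht)).deriv]
      exact hc.trans_le (hl t (interior_subset ht))
    · refine (strictAntiOn_of_deriv_neg (convex_Icc a b) hcont fun t ht => ?_).injOn
      rw [(hd t (interior_subset ht)).deriv]
      exact (hl t (interior_subset ht)).trans_lt (by linarith)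
  have hlow : ∀ t ∈ Set.Icc a b, c ≤ |f 1 t| := by
    intro t ht
    rcases hl with hl | hl
    · exact (hl t ht).trans (le_abs_self _)
    · exact (by linarith [hl t ht] : c ≤ -f 1 t).trans (neg_le_abs _)
  calc ∫⁻ t in Set.Icc a b, F (f 0 t)
      ≤ ∫⁻ t in Set.Icc a b, ENNReal.ofReal (1 / c) * (ENNReal.ofReal |f 1 t| * F (f 0 t)) := by
        refine setLIntegral_mono' measurableSet_Icc fun t ht => ?_
        rw [← mul_assoc, ← ENNReal.ofReal_mul (by positivity)]
        refine le_mul_of_one_le_left zero_le ?_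
        rw [ENNReal.one_le_ofReal, div_mul_eq_mul_div, le_div_iff₀ hc]
        linarith [hlow t ht]
    _ = ENNReal.ofReal (1 / c) * ∫⁻ u in f 0 '' Set.Icc a b, F u := by
        rw [lintegral_const_mul' _ _ ENNReal.ofReal_ne_top,
          lintegral_image_eq_lintegral_abs_deriv_mul measurableSet_Icc
            (fun t ht => (hd t ht).hasDerivWithinAt) hinj F]
    _ ≤ _ := by
        gcongr
        exact Measure.restrict_le_self

lemma LevelChart.setLIntegral_le {p τ : ℝ × ℝ → ℝ} {z₀ : ℝ × ℝ} {O : Set (ℝ × ℝ)}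
    (c : LevelChart p τ z₀ O) {F : ℝ × ℝ → ℝ≥0∞} {B : ℝ → ℝ≥0∞}
    (h : ∀ w ∈ Set.Icc (p z₀ - c.r) (p z₀ + c.r),
      ∫⁻ t in Set.Icc (τ z₀ - c.r) (τ z₀ + c.r), F (c.χ (w, t)) ≤ B w) :
    ∫⁻ z in c.U, F z ≤ ENNReal.ofReal c.C * ∫⁻ w, B w := by
  have hle : ∫⁻ z in c.U, F z ≤ ∫⁻ z in c.U, F (c.χ (p z, τ z)) :=
    setLIntegral_mono' c.isOpen.measurableSet fun z hz => by rw [c.leftInv z hz]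
  refine (hle.trans (c.lintegral_le fun ζ => F (c.χ ζ))).trans ?_
  gcongr
  rw [← closedBall_prod_same, Real.closedBall_eq_Icc, Real.closedBall_eq_Icc,
    Measure.volume_eq_prod, ← Measure.prod_restrict]
  exact (lintegral_prod_le _).trans ((setLIntegral_mono' measurableSet_Icc h).trans
    (setLIntegral_le_lintegral _ _))

lemma LevelChart.mem_closedBall {p τ : ℝ × ℝ → ℝ} {z₀ : ℝ × ℝ} {O : Set (ℝ × ℝ)}
    (c : LevelChart p τ z₀ O) {w t : ℝ} (hw : w ∈ Set.Icc (p z₀ - c.r) (p z₀ + c.r))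
    (ht : t ∈ Set.Icc (τ z₀ - c.r) (τ z₀ + c.r)) :
    (w, t) ∈ Metric.closedBall (p z₀, τ z₀) c.r := by
  rw [← closedBall_prod_same, Real.closedBall_eq_Icc, Real.closedBall_eq_Icc]
  exact ⟨hw, ht⟩

lemma exists_eventually_lower {X : Type*} [TopologicalSpace X] {f : X → ℝ} {z₀ : X}
    (hf : ContinuousAt f z₀) (h : f z₀ ≠ 0) :
    ∃ c > 0, (∀ᶠ z in nhds z₀, c ≤ f z) ∨ (∀ᶠ z in nhds z₀, f z ≤ -c) := by
  rcases lt_or_gt_of_ne h with h | h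
  · exact ⟨-f z₀ / 2, by linarith, Or.inr ((hf.eventually_lt_const
      (by linarith : f z₀ < f z₀ / 2)).mono fun z hz => by linarith)⟩
  · exact ⟨f z₀ / 2, by linarith, Or.inl ((hf.eventually_const_lt
      (by linarith : f z₀ / 2 < f z₀)).mono fun z hz => hz.le)⟩

lemma exists_eventually_abs_le {X : Type*} [TopologicalSpace X] {f : X → ℝ} {z₀ : X}
    (hf : ContinuousAt f z₀) : ∃ L > 0, ∀ᶠ z in nhds z₀, |f z| ≤ L :=
  ⟨|f z₀| + 1, by positivity, (hf.abs.eventually_lt_const (lt_add_one _)).mono fun _ h => h.le⟩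

lemma SmoothAt.iterate_levelDeriv {p τ f : ℝ × ℝ → ℝ} {z : ℝ × ℝ} (hp : SmoothAt p z)
    (hτ : SmoothAt τ z) (hf : SmoothAt f z) (hJ : _root_.jac p τ z ≠ 0) (n : ℕ) :
    SmoothAt ((_root_.levelDeriv p τ)^[n] f) z := by
  induction n with
  | zero => exact hf
  | succ n ih => rw [Function.iterate_succ_apply']; exact hp.levelDeriv hτ ih hJ

lemma LevelChart.hasDerivAt_iterate {p τ f : ℝ × ℝ → ℝ} {z₀ : ℝ × ℝ} {O : Set (ℝ × ℝ)}
    (c : LevelChart p τ z₀ O) (hp : ∀ z ∈ O, SmoothAt p z) (hτ : ∀ z ∈ O, SmoothAt τ z)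
    (hf : ∀ z ∈ O, SmoothAt f z) (hJ : ∀ z ∈ O, jac p τ z ≠ 0) {w t : ℝ}
    (h : (w, t) ∈ Metric.closedBall (p z₀, τ z₀) c.r) (n : ℕ) :
    HasDerivAt (fun t => (levelDeriv p τ)^[n] f (c.χ (w, t)))
      ((levelDeriv p τ)^[n + 1] f (c.χ (w, t))) t := by
  rw [Function.iterate_succ_apply']
  exact c.hasDerivAt hp hτ
    (fun z hz => (hp z hz).iterate_levelDeriv (hτ z hz) (hf z hz) (hJ z hz) n)
    hJ h

/-- The bounds from nonvanishing first or second derivatives, in a common form. -/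
lemma exists_lintegral_inv_add_abs_le_rpow {k : ℕ} (hk : k = 1 ∨ k = 2) {c ℓ : ℝ} (hc : 0 < c)
    (hℓ : 0 < ℓ) :
    ∃ K > 0, ∀ (f : ℕ → ℝ → ℝ) (a b M : ℝ), a ≤ b → b - a ≤ ℓ → 0 < M → DerivChain f k a b →
      DerivLower f k c a b → ∫⁻ t in Set.Icc a b, ENNReal.ofReal (1 / (M + |f 0 t|))
        ≤ ENNReal.ofReal (K * M ^ (-(1 / 2) : ℝ)) := by
  rcases hk with rfl | rfl
  · exact exists_lintegral_inv_add_abs_le_of_first hc hℓ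
  · obtain ⟨K, hK, H⟩ := exists_lintegral_inv_add_abs_le (le_refl 2) hc
    refine ⟨K, hK, fun f a b M hab _ hM hf hl => ?_⟩
    have := H f a b M hab hM hf hl
    norm_num at this ⊢
    exact this

lemma inv_sq_add_sq_le {δ v h : ℝ} (hδ : 0 < δ) :
    1 / (δ ^ 2 + v ^ 2 + h ^ 2) ≤ 3 * (δ + |v|)⁻¹ * (1 / (δ + |v| + |h|)) := by
  have hM : 0 < δ + |v| := by positivity
  have h1 : 0 < δ + |v| + |h| := by positivity
  rw [← div_eq_mul_inv, div_mul_div_comm, mul_one, div_le_div_iff₀ (by positivity) (by positivity)]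
  have hv := sq_abs v
  have hh := sq_abs h
  nlinarith [sq_nonneg (δ - |v|), sq_nonneg (δ + |v| - |h|)]

lemma add_abs_rpow_eq {δ v : ℝ} (hδ : 0 < δ) (r : ℝ) :
    (δ + |v|) ^ r = δ ^ r * (1 + |v / δ|) ^ r := by
  rw [← mul_rpow hδ.le (by positivity), abs_div, abs_of_pos hδ]
  congr 1
  field_simp

lemma exists_lintegral_inv_sq_le {p q τ : ℝ × ℝ → ℝ} {z₀ : ℝ × ℝ} {k : ℕ} (hk : k = 1 ∨ k = 2)
    (hp : ∀ᶠ z in nhds z₀, SmoothAt p z) (hq : ∀ᶠ z in nhds z₀, SmoothAt q z)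
    (hτ : ∀ᶠ z in nhds z₀, SmoothAt τ z) (hJ : jac p τ z₀ ≠ 0)
    (hX : (levelDeriv p τ)^[k] q z₀ ≠ 0) :
    ∃ U ∈ nhds z₀, ∃ C > 0, ∀ δ > 0, ∀ σ₁ σ₂ : ℝ,
      ∫⁻ z in U, ENNReal.ofReal (1 / (δ ^ 2 + (p z - σ₁) ^ 2 + (q z - σ₂) ^ 2))
        ≤ ENNReal.ofReal (C * δ ^ (-(1 / 2) : ℝ)) := by
  have hp₀ := hp.self_of_nhds
  have hτ₀ := hτ.self_of_nhds
  obtain ⟨c, hc, hlow⟩ := exists_eventually_lower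
    (hp₀.iterate_levelDeriv hτ₀ hq.self_of_nhds hJ k).continuousAt hX
  have hJ' : ∀ᶠ z in nhds z₀, jac p τ z ≠ 0 := (hp₀.jac hτ₀).continuousAt.eventually_ne hJ
  have hO : ∃ O ∈ nhds z₀, (∀ z ∈ O, SmoothAt p z) ∧ (∀ z ∈ O, SmoothAt q z) ∧
      (∀ z ∈ O, SmoothAt τ z) ∧ (∀ z ∈ O, jac p τ z ≠ 0) ∧
      ((∀ z ∈ O, c ≤ (levelDeriv p τ)^[k] q z) ∨ (∀ z ∈ O, (levelDeriv p τ)^[k] q z ≤ -c)) := by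
    rcases hlow with hlow | hlow
    · have := hp.and (hq.and (hτ.and (hJ'.and hlow)))
      exact ⟨_, this, fun z hz => hz.1, fun z hz => hz.2.1, fun z hz => hz.2.2.1,
        fun z hz => hz.2.2.2.1, Or.inl fun z hz => hz.2.2.2.2⟩
    · have := hp.and (hq.and (hτ.and (hJ'.and hlow)))
      exact ⟨_, this, fun z hz => hz.1, fun z hz => hz.2.1, fun z hz => hz.2.2.1,
        fun z hz => hz.2.2.2.1, Or.inr fun z hz => hz.2.2.2.2⟩
  obtain ⟨O, hO, hpO, hqO, hτO, hJO, hlO⟩ := hO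
  obtain ⟨χ⟩ := nonempty_levelChart hO hpO hτO hJ
  obtain ⟨K, hK, hKle⟩ := exists_lintegral_inv_add_abs_le_rpow hk hc (ℓ := 2 * χ.r)
    (by linarith [χ.r_pos])
  obtain ⟨K', hK', hK'le⟩ := exists_lintegral_one_add_abs_rpow_le (r := 3 / 2) (by norm_num)
  refine ⟨χ.U, χ.U_mem, χ.C * (3 * K * K'), by have := χ.C_pos; positivity, fun δ hδ σ₁ σ₂ => ?_⟩
  have hfib : ∀ w ∈ Set.Icc (p z₀ - χ.r) (p z₀ + χ.r),
      ∫⁻ t in Set.Icc (τ z₀ - χ.r) (τ z₀ + χ.r), ENNReal.ofReal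
        (1 / (δ ^ 2 + (p (χ.χ (w, t)) - σ₁) ^ 2 + (q (χ.χ (w, t)) - σ₂) ^ 2))
      ≤ ENNReal.ofReal (3 * K * δ ^ (-(3 / 2) : ℝ)) *
        ENNReal.ofReal ((1 + |(w - σ₁) / δ|) ^ (-(3 / 2) : ℝ)) := by
    intro w hw
    set M := δ + |w - σ₁| with hM
    have hM0 : 0 < M := by positivity
    set f : ℕ → ℝ → ℝ := fun j t => (levelDeriv p τ)^[j] q (χ.χ (w, t)) - if j = 0 then σ₂ else 0
      with hf
    have hchain : DerivChain f k (τ z₀ - χ.r) (τ z₀ + χ.r) := by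
      intro j _ t ht
      have := (χ.hasDerivAt_iterate hpO hτO hqO hJO (χ.mem_closedBall hw ht) j).sub_const
        (if j = 0 then σ₂ else 0)
      simpa [hf] using this
    have hk0 : k ≠ 0 := by omega
    have hlower : DerivLower f k c (τ z₀ - χ.r) (τ z₀ + χ.r) := by
      rcases hlO with h | h
      · exact Or.inl fun t ht => by
          simpa [hf, hk0] using h _ (χ.mem_O _ (χ.mem_closedBall hw ht))
      · exact Or.inr fun t ht => by
          simpa [hf, hk0] using h _ (χ.mem_O _ (χ.mem_closedBall hw ht))
    have h1 := hKle f _ _ M (by linarith [χ.r_pos]) (by linarith) hM0 hchain hlower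
    calc _ ≤ ∫⁻ t in Set.Icc (τ z₀ - χ.r) (τ z₀ + χ.r), ENNReal.ofReal (3 * M⁻¹) *
            ENNReal.ofReal (1 / (M + |f 0 t|)) := by
          refine setLIntegral_mono' measurableSet_Icc fun t ht => ?_
          rw [← ENNReal.ofReal_mul (by positivity)]
          refine ENNReal.ofReal_le_ofReal ?_
          have hpw : p (χ.χ (w, t)) = w := congrArg Prod.fst
            (χ.rightInv _ (χ.mem_closedBall hw ht)).self_of_nhds
          rw [hpw]
          simpa [hf] using inv_sq_add_sq_le (v := w - σ₁) (h := q (χ.χ (w, t)) - σ₂) hδ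
      _ = ENNReal.ofReal (3 * M⁻¹) * ∫⁻ t in Set.Icc (τ z₀ - χ.r) (τ z₀ + χ.r),
            ENNReal.ofReal (1 / (M + |f 0 t|)) := lintegral_const_mul' _ _ ENNReal.ofReal_ne_top
      _ ≤ ENNReal.ofReal (3 * M⁻¹) * ENNReal.ofReal (K * M ^ (-(1 / 2) : ℝ)) := by gcongr
      _ = _ := by
          rw [← ENNReal.ofReal_mul (by positivity), ← ENNReal.ofReal_mul (by positivity)]
          congr 1
          rw [mul_assoc (3 * K), ← add_abs_rpow_eq hδ, ← hM,
            show (-(3 / 2) : ℝ) = -1 + -(1 / 2) by norm_num, rpow_add hM0, rpow_neg_one]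
          ring
  refine (χ.setLIntegral_le hfib).trans ?_
  rw [lintegral_const_mul' _ _ ENNReal.ofReal_ne_top]
  calc _ ≤ ENNReal.ofReal χ.C * (ENNReal.ofReal (3 * K * δ ^ (-(3 / 2) : ℝ)) *
        ENNReal.ofReal (K' * δ)) := by gcongr; exact hK'le σ₁ δ hδ
    _ = _ := by
      rw [← ENNReal.ofReal_mul (by positivity), ← ENNReal.ofReal_mul χ.C_pos.le]
      congr 1
      rw [show (-(1 / 2) : ℝ) = -(3 / 2) + 1 by norm_num, rpow_add hδ, rpow_one]
      ring

lemma exists_lintegral_line_le {O : Set (ℝ × ℝ)} {z₀ : ℝ × ℝ} (hO : O ∈ nhds z₀)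
    {e : ℝ → ℝ → ℝ × ℝ} (he : ∀ y x x', |x - x'| ≤ dist (e y x) (e y x'))
    {F : ℕ → ℝ × ℝ → ℝ}
    (hF : ∀ j y x, e y x ∈ O → HasDerivAt (fun x => F j (e y x)) (F (j + 1) (e y x)) x)
    (hc : ∀ j, ContinuousAt (F j) z₀) (h : F 1 z₀ ≠ 0 ∨ F 2 z₀ ≠ 0) :
    ∃ U ∈ nhds z₀, ∃ K > 0, ∀ α β y, α ≤ β → (∀ x ∈ Set.Icc α β, e y x ∈ U) →
      ∀ δ > 0, ∀ σ : ℝ, ∫⁻ x in Set.Icc α β, ENNReal.ofReal (1 / (δ + |F 0 (e y x) - σ|))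
        ≤ ENNReal.ofReal (K * δ ^ (-(1 / 2) : ℝ)) := by
  obtain ⟨k, hk, hk'⟩ : ∃ k, (k = 1 ∨ k = 2) ∧ F k z₀ ≠ 0 := by
    rcases h with h | h
    exacts [⟨1, Or.inl rfl, h⟩, ⟨2, Or.inr rfl, h⟩]
  obtain ⟨c, hc0, hlow⟩ := exists_eventually_lower (hc k) hk'
  obtain ⟨K, hK, hKle⟩ := exists_lintegral_inv_add_abs_le_rpow hk hc0 one_pos
  obtain ⟨V, hV, hVs⟩ : ∃ V ∈ nhds z₀, (∀ z ∈ V, c ≤ F k z) ∨ (∀ z ∈ V, F k z ≤ -c) := by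
    rcases hlow with h | h
    exacts [⟨_, h, Or.inl fun z hz => hz⟩, ⟨_, h, Or.inr fun z hz => hz⟩]
  refine ⟨O ∩ V ∩ Metric.ball z₀ (1 / 2), Filter.inter_mem (Filter.inter_mem hO hV)
    (Metric.ball_mem_nhds _ (by norm_num)), K, hK, fun α β y hαβ hU δ hδ σ => ?_⟩
  have hlen : β - α ≤ 1 := by
    have h1 := (hU α (Set.left_mem_Icc.2 hαβ)).2
    have h2 := (hU β (Set.right_mem_Icc.2 hαβ)).2
    rw [Metric.mem_ball] at h1 h2
    linarith [le_abs_self (β - α), he y β α, dist_triangle_right (e y β) (e y α) z₀]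
  have hk0 : k ≠ 0 := by omega
  have := hKle (fun j x => F j (e y x) - if j = 0 then σ else 0) α β δ hαβ hlen hδ
    (fun j _ x hx => by simpa using (hF j y x (hU x hx).1.1).sub_const (if j = 0 then σ else 0))
    (hVs.imp (fun h x hx => by simpa [hk0] using h _ (hU x hx).1.2)
      (fun h x hx => by simpa [hk0] using h _ (hU x hx).1.2))
  simpa using this

lemma SmoothAt.dx_eq {f : ℝ × ℝ → ℝ} {z : ℝ × ℝ} {c : ℝ} (h : SmoothAt f z)
    (hc : HasDerivAt (fun x => f (x, z.2)) c z.1) : _root_.dx f z = c :=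
  (SmoothAt.hasDerivAt_fst (x := z.1) (y := z.2) h).unique hc

lemma SmoothAt.dy_eq {f : ℝ × ℝ → ℝ} {z : ℝ × ℝ} {c : ℝ} (h : SmoothAt f z)
    (hc : HasDerivAt (fun y => f (z.1, y)) c z.2) : _root_.dy f z = c :=
  (SmoothAt.hasDerivAt_snd (x := z.1) (y := z.2) h).unique hc

/-- The phase `W(x, y) - σ₁ x - σ₂ y`. -/
def tilt (W : ℝ × ℝ → ℝ) (σ₁ σ₂ : ℝ) (z : ℝ × ℝ) : ℝ := W z - (σ₁ * z.1 + σ₂ * z.2)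

lemma smoothAt_fst {z : ℝ × ℝ} : SmoothAt Prod.fst z := contDiffAt_fst

lemma smoothAt_snd {z : ℝ × ℝ} : SmoothAt Prod.snd z := contDiffAt_snd

lemma SmoothAt.tilt {W : ℝ × ℝ → ℝ} {z : ℝ × ℝ} (h : SmoothAt W z) (σ₁ σ₂ : ℝ) :
    SmoothAt (tilt W σ₁ σ₂) z :=
  h.sub ((contDiffAt_const.mul smoothAt_fst).add (contDiffAt_const.mul smoothAt_snd))

lemma SmoothAt.dx_tilt {W : ℝ × ℝ → ℝ} {z : ℝ × ℝ} (h : SmoothAt W z) (σ₁ σ₂ : ℝ) :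
    _root_.dx (_root_.tilt W σ₁ σ₂) z = _root_.dx W z - σ₁ := by
  refine (h.tilt σ₁ σ₂).dx_eq ?_
  have := (h.hasDerivAt_fst (x := z.1) (y := z.2)).sub
    (((hasDerivAt_id z.1).const_mul σ₁).add_const (σ₂ * z.2))
  rw [mul_one] at this
  exact this

lemma SmoothAt.dy_tilt {W : ℝ × ℝ → ℝ} {z : ℝ × ℝ} (h : SmoothAt W z) (σ₁ σ₂ : ℝ) :
    _root_.dy (_root_.tilt W σ₁ σ₂) z = _root_.dy W z - σ₂ := by
  refine (h.tilt σ₁ σ₂).dy_eq ?_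
  have := (h.hasDerivAt_snd (x := z.1) (y := z.2)).sub
    (((hasDerivAt_id z.2).const_mul σ₂).const_add (σ₁ * z.1))
  rw [mul_one] at this
  exact this

/-- Uniform decay of order `3/4` for the integrals over all small rectangles near `z₀`. -/
def LocalDecay (W : ℝ × ℝ → ℝ) (z₀ : ℝ × ℝ) : Prop :=
  ∃ U ∈ nhds z₀, ∃ C > 0, ∀ a b : ℝ × ℝ, a ≤ b → Set.Icc a b ⊆ U → ∀ lam ≥ (1 : ℝ),
    ∀ σ₁ σ₂ : ℝ, ‖∫ z in Set.Icc a b, osc lam (tilt W σ₁ σ₂) z‖ ≤ C * lam ^ (-(3 / 4) : ℝ)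

lemma le_mul_rpow_of_mul_le {lam n C : ℝ} (hlam : 0 < lam) (h : lam * n ≤ C * lam ^ (1 / 4 : ℝ)) :
    n ≤ C * lam ^ (-(3 / 4) : ℝ) := by
  rw [show (-(3 / 4) : ℝ) = 1 / 4 - 1 by norm_num, rpow_sub_one hlam.ne', ← mul_div_assoc,
    le_div_iff₀ hlam]
  linarith

lemma abs_quotient_deriv_le {S v h vx hx L δ : ℝ} (hS : S = δ ^ 2 + v ^ 2 + h ^ 2)
    (hδ : 0 < δ) (hL : 0 < L) (h1 : |vx| ≤ L) (h2 : |hx| ≤ L) :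
    |(vx * S - v * (2 * v * vx + 2 * h * hx)) / S ^ 2| ≤ 4 * L / S := by
  have hS0 : 0 < S := by rw [hS]; positivity
  rw [abs_div, abs_of_pos (by positivity : 0 < S ^ 2), div_le_div_iff₀ (by positivity) hS0]
  have e1 : |vx * S| ≤ L * S := by rw [abs_mul, abs_of_pos hS0]; gcongr
  have e2 : |v * (2 * v * vx + 2 * h * hx)| ≤ 3 * S * L := by
    calc |v * (2 * v * vx + 2 * h * hx)| = |2 * v ^ 2 * vx + 2 * (v * h) * hx| := by ring_nf
      _ ≤ |2 * v ^ 2 * vx| + |2 * (v * h) * hx| := abs_add_le _ _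
      _ = 2 * v ^ 2 * |vx| + 2 * (|v| * |h|) * |hx| := by
          rw [abs_mul (2 * v ^ 2), abs_mul (2 * (v * h)), abs_mul 2 (v * h), abs_mul v h,
            abs_of_nonneg (by positivity : 0 ≤ 2 * v ^ 2), abs_of_pos (by norm_num : (0 : ℝ) < 2)]
      _ ≤ 2 * v ^ 2 * L + 2 * (|v| * |h|) * L := by gcongr
      _ = (2 * v ^ 2 + 2 * (|v| * |h|)) * L := by ring
      _ ≤ 3 * S * L := by
          gcongr
          rw [hS]
          nlinarith [sq_nonneg (|v| - |h|), sq_abs v, sq_abs h, sq_nonneg δ]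
  calc _ ≤ (|vx * S| + |v * (2 * v * vx + 2 * h * hx)|) * S := by gcongr; exact abs_sub _ _
    _ ≤ (L * S + 3 * S * L) * S := by gcongr
    _ = _ := by ring

lemma abs_div_le_two_div {S v h u δ : ℝ} (hS : S = δ ^ 2 + v ^ 2 + h ^ 2) (hδ : 0 < δ)
    (hu : u = v ∨ u = h) (w : ℝ) (hw : w = v ∨ w = h) : |u / S| ≤ 2 * (1 / (δ + |w|)) := by
  have hS0 : 0 < S := by rw [hS]; positivity
  rw [abs_div, abs_of_pos hS0, mul_one_div, div_le_div_iff₀ hS0 (by positivity), hS]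
  have hv := sq_abs v
  have hh := sq_abs h
  rcases hu with rfl | rfl <;> rcases hw with rfl | rfl
  · nlinarith [sq_nonneg (|w| - δ), sq_nonneg h]
  · nlinarith [sq_nonneg (|u| - δ), sq_nonneg (|u| - |w|)]
  · nlinarith [sq_nonneg (|u| - δ), sq_nonneg (|u| - |w|)]
  · nlinarith [sq_nonneg (|w| - δ), sq_nonneg v]

lemma exists_lintegral_horizontal_le {f : ℝ × ℝ → ℝ} {z₀ : ℝ × ℝ}
    (hf : ∀ᶠ z in nhds z₀, SmoothAt f z) (h : dx f z₀ ≠ 0 ∨ dx (dx f) z₀ ≠ 0) :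
    ∃ U ∈ nhds z₀, ∃ K > 0, ∀ α β y, α ≤ β → (∀ x ∈ Set.Icc α β, (x, y) ∈ U) →
      ∀ δ > 0, ∀ σ : ℝ, ∫⁻ x in Set.Icc α β, ENNReal.ofReal (1 / (δ + |f (x, y) - σ|))
        ≤ ENNReal.ofReal (K * δ ^ (-(1 / 2) : ℝ)) := by
  have hs : ∀ (j : ℕ) z, SmoothAt f z → SmoothAt (dx^[j] f) z := by
    intro j z hz
    induction j with
    | zero => exact hz
    | succ j ih => rw [Function.iterate_succ_apply']; exact ih.dx
  refine exists_lintegral_line_le (F := fun j => dx^[j] f) (e := fun y x => (x, y)) hf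
    (fun y x x' => ?_) (fun j y x hz => ?_) (fun j => (hs j z₀ hf.self_of_nhds).continuousAt) h
  · simp [Prod.dist_eq, Real.dist_eq]
  · simp only [Function.iterate_succ_apply']
    exact (hs j _ hz).hasDerivAt_fst

lemma exists_lintegral_vertical_le {f : ℝ × ℝ → ℝ} {z₀ : ℝ × ℝ}
    (hf : ∀ᶠ z in nhds z₀, SmoothAt f z) (h : dy f z₀ ≠ 0 ∨ dy (dy f) z₀ ≠ 0) :
    ∃ U ∈ nhds z₀, ∃ K > 0, ∀ α β x, α ≤ β → (∀ y ∈ Set.Icc α β, (x, y) ∈ U) →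
      ∀ δ > 0, ∀ σ : ℝ, ∫⁻ y in Set.Icc α β, ENNReal.ofReal (1 / (δ + |f (x, y) - σ|))
        ≤ ENNReal.ofReal (K * δ ^ (-(1 / 2) : ℝ)) := by
  have hs : ∀ (j : ℕ) z, SmoothAt f z → SmoothAt (dy^[j] f) z := by
    intro j z hz
    induction j with
    | zero => exact hz
    | succ j ih => rw [Function.iterate_succ_apply']; exact ih.dy
  refine exists_lintegral_line_le (F := fun j => dy^[j] f) (e := fun x y => (x, y)) hf
    (fun y x x' => ?_) (fun j y x hz => ?_) (fun j => (hs j z₀ hf.self_of_nhds).continuousAt) h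
  · simp [Prod.dist_eq, Real.dist_eq]
  · simp only [Function.iterate_succ_apply']
    exact (hs j _ hz).hasDerivAt_snd

lemma setLIntegral_ofReal_le_of_le {X : Type*} [MeasurableSpace X] {μ : Measure X} {S : Set X}
    (hS : MeasurableSet S) {f g : X → ℝ} {c B : ℝ} (hc : 0 ≤ c)
    (hfg : ∀ x ∈ S, f x ≤ c * g x)
    (hg : ∫⁻ x in S, ENNReal.ofReal (g x) ∂μ ≤ ENNReal.ofReal B) :
    ∫⁻ x in S, ENNReal.ofReal (f x) ∂μ ≤ ENNReal.ofReal (c * B) := by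
  calc ∫⁻ x in S, ENNReal.ofReal (f x) ∂μ
      ≤ ∫⁻ x in S, ENNReal.ofReal c * ENNReal.ofReal (g x) ∂μ :=
        setLIntegral_mono' hS fun x hx => by
          rw [← ENNReal.ofReal_mul hc]; exact ENNReal.ofReal_le_ofReal (hfg x hx)
    _ ≤ ENNReal.ofReal c * ENNReal.ofReal B := by
        rw [lintegral_const_mul' _ _ ENNReal.ofReal_ne_top]; gcongr
    _ = _ := (ENNReal.ofReal_mul hc).symm

/-- Decay from an area bound for the regularised inverse square of the gradient. -/
theorem localDecay_of_lintegral_inv_sq_le {W : ℝ × ℝ → ℝ} {z₀ : ℝ × ℝ}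
    (hW : ∀ᶠ z in nhds z₀, SmoothAt W z)
    (hx : dx (dx W) z₀ ≠ 0 ∨ dx (dx (dx W)) z₀ ≠ 0)
    (hy : dy (dy W) z₀ ≠ 0 ∨ dy (dy (dy W)) z₀ ≠ 0)
    (harea : ∃ U ∈ nhds z₀, ∃ C > 0, ∀ δ > 0, ∀ σ₁ σ₂ : ℝ,
      ∫⁻ z in U, ENNReal.ofReal (1 / (δ ^ 2 + (dx W z - σ₁) ^ 2 + (dy W z - σ₂) ^ 2))
        ≤ ENNReal.ofReal (C * δ ^ (-(1 / 2) : ℝ))) : LocalDecay W z₀ := by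
  obtain ⟨U₁, hU₁, K₁, hK₁, H₁⟩ := exists_lintegral_horizontal_le (hW.mono fun z h => h.dx) hx
  obtain ⟨U₂, hU₂, K₂, hK₂, H₂⟩ := exists_lintegral_vertical_le (hW.mono fun z h => h.dy) hy
  obtain ⟨U₃, hU₃, K₃, hK₃, H₃⟩ := harea
  have hW₀ := hW.self_of_nhds
  obtain ⟨L₁, hL₁, B₁⟩ := exists_eventually_abs_le hW₀.dx.dx.continuousAt
  obtain ⟨L₂, hL₂, B₂⟩ := exists_eventually_abs_le hW₀.dx.dy.continuousAt
  obtain ⟨L₃, hL₃, B₃⟩ := exists_eventually_abs_le hW₀.dy.dx.continuousAt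
  obtain ⟨L₄, hL₄, B₄⟩ := exists_eventually_abs_le hW₀.dy.dy.continuousAt
  set L := L₁ + L₂ + L₃ + L₄ with hL
  refine ⟨U₁ ∩ (U₂ ∩ (U₃ ∩ {z | SmoothAt W z ∧ |dx (dx W) z| ≤ L₁ ∧ |dy (dx W) z| ≤ L₂ ∧
    |dx (dy W) z| ≤ L₃ ∧ |dy (dy W) z| ≤ L₄})), Filter.inter_mem hU₁ (Filter.inter_mem hU₂
    (Filter.inter_mem hU₃ (hW.and (B₁.and (B₂.and (B₃.and B₄)))))),
    (1 + 8 * L) * K₃ + 4 * K₁ + 4 * K₂, by positivity, ?_⟩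
  intro a b hab hsub lam hlam σ₁ σ₂
  have hlam0 : 0 < lam := by linarith
  refine le_mul_rpow_of_mul_le hlam0 ?_
  set δ := lam ^ (-(1 / 2) : ℝ) with hδ
  have hδ0 : 0 < δ := rpow_pos_of_pos hlam0 _
  have hδ2 : lam * δ ^ 2 = 1 := by
    rw [hδ, ← rpow_natCast, ← rpow_mul hlam0.le]; norm_num
    rw [rpow_neg_one, mul_inv_cancel₀ hlam0.ne']
  have hδr : δ ^ (-(1 / 2) : ℝ) = lam ^ (1 / 4 : ℝ) := by
    rw [hδ, ← rpow_mul hlam0.le]; norm_num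
  set v : ℝ × ℝ → ℝ := fun z => dx W z - σ₁ with hv
  set h : ℝ × ℝ → ℝ := fun z => dy W z - σ₂ with hh
  set S : ℝ × ℝ → ℝ := fun z => δ ^ 2 + v z ^ 2 + h z ^ 2 with hS
  have hS0 : ∀ z, 0 < S z := fun z => by positivity
  have hWs : ∀ z ∈ Set.Icc a b, SmoothAt W z := fun z hz => (hsub hz).2.2.2.1
  have hvs : ∀ z ∈ Set.Icc a b, SmoothAt v z := fun z hz => (hWs z hz).dx.sub contDiffAt_const
  have hhs : ∀ z ∈ Set.Icc a b, SmoothAt h z := fun z hz => (hWs z hz).dy.sub contDiffAt_const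
  have hSs : ∀ z ∈ Set.Icc a b, SmoothAt S z := fun z hz =>
    (contDiffAt_const.add ((hvs z hz).pow 2)).add ((hhs z hz).pow 2)
  have hAs : ∀ z ∈ Set.Icc a b, SmoothAt (fun z => v z / S z) z := fun z hz =>
    (hvs z hz).div (hSs z hz) (hS0 z).ne'
  have hBs : ∀ z ∈ Set.Icc a b, SmoothAt (fun z => h z / S z) z := fun z hz =>
    (hhs z hz).div (hSs z hz) (hS0 z).ne'
  have hmain := ofReal_mul_norm_setIntegral_osc_le hab hlam0.le
    (fun z hz => (hWs z hz).tilt σ₁ σ₂) hAs hBs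
  have harea := H₃ δ hδ0 σ₁ σ₂
  have hI : ∫⁻ z in Set.Icc a b, ENNReal.ofReal (lam * |1 - (v z / S z * dx (tilt W σ₁ σ₂) z
      + h z / S z * dy (tilt W σ₁ σ₂) z)| + |dx (fun z => v z / S z) z + dy (fun z => h z / S z) z|)
      ≤ ENNReal.ofReal ((1 + 8 * L) * (K₃ * δ ^ (-(1 / 2) : ℝ))) := by
    refine setLIntegral_ofReal_le_of_le (g := fun z => 1 / S z) measurableSet_Icc (by positivity)
      (fun z hz => ?_)
      ((lintegral_mono_set fun z hz => (hsub hz).2.2.1).trans harea)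
    obtain ⟨-, -, -, hWz, b1, b2, b3, b4⟩ := hsub hz
    have e1 : lam * |1 - (v z / S z * dx (tilt W σ₁ σ₂) z + h z / S z * dy (tilt W σ₁ σ₂) z)|
        = 1 / S z := by
      rw [hWz.dx_tilt, hWz.dy_tilt]
      have : 1 - (v z / S z * (dx W z - σ₁) + h z / S z * (dy W z - σ₂)) = δ ^ 2 / S z := by
        have := (hS0 z).ne'
        field_simp
        simp only [hS, hv, hh]; ring
      rw [this, abs_of_pos (div_pos (by positivity) (hS0 z)), ← mul_div_assoc, hδ2]
    have e2 : |dx (fun z => v z / S z) z| ≤ 4 * L / S z := by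
      have d1 : HasDerivAt (fun x => v (x, z.2)) (dx (dx W) z) z.1 :=
        (hWz.dx.hasDerivAt_fst (x := z.1) (y := z.2)).sub_const σ₁
      have d2 : HasDerivAt (fun x => h (x, z.2)) (dx (dy W) z) z.1 :=
        (hWz.dy.hasDerivAt_fst (x := z.1) (y := z.2)).sub_const σ₂
      have d3 : HasDerivAt (fun x => S (x, z.2))
          (2 * v z * dx (dx W) z + 2 * h z * dx (dy W) z) z.1 :=
        (((d1.pow 2).const_add (δ ^ 2)).add (d2.pow 2)).congr_deriv (by norm_num)
      rw [(hAs z hz).dx_eq (d1.div d3 (hS0 z).ne')]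
      exact abs_quotient_deriv_le rfl hδ0 (by positivity) (by linarith) (by linarith)
    have e3 : |dy (fun z => h z / S z) z| ≤ 4 * L / S z := by
      have d1 : HasDerivAt (fun y => v (z.1, y)) (dy (dx W) z) z.2 :=
        (hWz.dx.hasDerivAt_snd (x := z.1) (y := z.2)).sub_const σ₁
      have d2 : HasDerivAt (fun y => h (z.1, y)) (dy (dy W) z) z.2 :=
        (hWz.dy.hasDerivAt_snd (x := z.1) (y := z.2)).sub_const σ₂
      have d3 : HasDerivAt (fun y => S (z.1, y))
          (2 * h z * dy (dy W) z + 2 * v z * dy (dx W) z) z.2 :=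
        (((d1.pow 2).const_add (δ ^ 2)).add (d2.pow 2)).congr_deriv (by norm_num; ring)
      rw [(hBs z hz).dy_eq (d2.div d3 (hS0 z).ne')]
      exact abs_quotient_deriv_le (by simp only [hS]; ring) hδ0 (by positivity) (by linarith)
        (by linarith)
    rw [e1]
    calc _ ≤ 1 / S z + (4 * L / S z + 4 * L / S z) := by
          gcongr; exact (abs_add_le _ _).trans (add_le_add e2 e3)
      _ = _ := by ring
  have hx' : ∀ y, (∀ x ∈ Set.Icc a.1 b.1, (x, y) ∈ Set.Icc a b) →
      ∫⁻ x in Set.Icc a.1 b.1, ENNReal.ofReal |h (x, y) / S (x, y)|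
        ≤ ENNReal.ofReal (2 * (K₁ * δ ^ (-(1 / 2) : ℝ))) := fun y hy =>
    setLIntegral_ofReal_le_of_le measurableSet_Icc (by norm_num)
      (fun x hx => abs_div_le_two_div rfl hδ0 (Or.inr rfl) (v (x, y)) (Or.inl rfl))
      (H₁ a.1 b.1 y hab.1 (fun x hx => (hsub (hy x hx)).1) δ hδ0 σ₁)
  have hy' : ∀ x, (∀ y ∈ Set.Icc a.2 b.2, (x, y) ∈ Set.Icc a b) →
      ∫⁻ y in Set.Icc a.2 b.2, ENNReal.ofReal |v (x, y) / S (x, y)|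
        ≤ ENNReal.ofReal (2 * (K₂ * δ ^ (-(1 / 2) : ℝ))) := fun x hx =>
    setLIntegral_ofReal_le_of_le measurableSet_Icc (by norm_num)
      (fun y hy => abs_div_le_two_div rfl hδ0 (Or.inl rfl) (h (x, y)) (Or.inr rfl))
      (H₂ a.2 b.2 x hab.2 (fun y hy => (hsub (hx y hy)).2.1) δ hδ0 σ₂)
  have e1 := hx' b.2 fun x hx => ⟨⟨hx.1, hab.2⟩, ⟨hx.2, le_rfl⟩⟩
  have e2 := hx' a.2 fun x hx => ⟨⟨hx.1, le_rfl⟩, ⟨hx.2, hab.2⟩⟩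
  have e3 := hy' b.1 fun y hy => ⟨⟨hab.1, hy.1⟩, ⟨le_rfl, hy.2⟩⟩
  have e4 := hy' a.1 fun y hy => ⟨⟨le_rfl, hy.1⟩, ⟨hab.1, hy.2⟩⟩
  have htot := hmain.trans (add_le_add (add_le_add (add_le_add (add_le_add hI e1) e2) e3) e4)
  rw [hδr] at htot
  have hr : 0 < lam ^ (1 / 4 : ℝ) := rpow_pos_of_pos hlam0 _
  rw [← ENNReal.ofReal_add (by positivity) (by positivity),
    ← ENNReal.ofReal_add (by positivity) (by positivity),
    ← ENNReal.ofReal_add (by positivity) (by positivity),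
    ← ENNReal.ofReal_add (by positivity) (by positivity),
    ENNReal.ofReal_le_ofReal_iff (by positivity)] at htot
  linarith

lemma exists_lintegral_line_comp_le {e : ℝ → ℝ → ℝ × ℝ} {f f' : ℝ × ℝ → ℝ} {z₀ : ℝ × ℝ}
    (hf : ∀ᶠ z in nhds z₀, ∀ y x, e y x = z → HasDerivAt (fun x => f (e y x)) (f' z) x)
    (hc : ContinuousAt f' z₀) (h : f' z₀ ≠ 0) :
    ∃ U ∈ nhds z₀, ∃ K > 0, ∀ α β y, (∀ x ∈ Set.Icc α β, e y x ∈ U) →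
      ∀ δ > 0, ∀ σ : ℝ, ∫⁻ x in Set.Icc α β,
        ENNReal.ofReal ((1 + |(f (e y x) - σ) / δ|) ^ (-2 : ℝ)) ≤ ENNReal.ofReal (K * δ) := by
  obtain ⟨c, hc0, hlow⟩ := exists_eventually_lower hc h
  obtain ⟨V, hV, hVs⟩ : ∃ V ∈ nhds z₀, (∀ z ∈ V, c ≤ f' z) ∨ (∀ z ∈ V, f' z ≤ -c) := by
    rcases hlow with h | h
    exacts [⟨_, h, Or.inl fun z hz => hz⟩, ⟨_, h, Or.inr fun z hz => hz⟩]
  obtain ⟨K, hK, hKle⟩ := exists_lintegral_one_add_abs_rpow_le (r := 2) (by norm_num)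
  refine ⟨_, Filter.inter_mem hf hV, 1 / c * K, by positivity, fun α β y hU δ hδ σ => ?_⟩
  refine (lintegral_comp_le_of_derivLower (f := fun j x => if j = 0 then f (e y x) else f' (e y x))
    hc0 (fun j hj x hx => ?_) ?_
    (fun w => ENNReal.ofReal ((1 + |(w - σ) / δ|) ^ (-2 : ℝ)))).trans ?_
  · obtain rfl : j = 0 := by omega
    simpa using (hU x hx).1 y x rfl
  · exact hVs.imp (fun h x hx => by simpa using h _ (hU x hx).2)
      (fun h x hx => by simpa using h _ (hU x hx).2)
  · rw [mul_assoc, ENNReal.ofReal_mul (by positivity)]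
    gcongr
    exact hKle σ δ hδ

/-- Area bounds near a point where the third derivative of `q` along the level curves of `p`
does not vanish, stable under perturbations of `q` by small multiples of `m`. -/
lemma exists_lintegral_third_le {p q τ m : ℝ × ℝ → ℝ} {z₀ : ℝ × ℝ}
    (hp : ∀ᶠ z in nhds z₀, SmoothAt p z) (hq : ∀ᶠ z in nhds z₀, SmoothAt q z)
    (hτ : ∀ᶠ z in nhds z₀, SmoothAt τ z) (hm : ∀ᶠ z in nhds z₀, SmoothAt m z)
    (hJ : jac p τ z₀ ≠ 0) (hX : (levelDeriv p τ)^[3] q z₀ ≠ 0) :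
    ∃ U ∈ nhds z₀, ∃ η > 0, ∃ C > 0, ∀ δ > 0, ∀ γ > 0, ∀ σ₁ σ₂ : ℝ, |p z₀ - σ₁| ≤ η →
      ∫⁻ z in U, ENNReal.ofReal (1 / ((1 + |(p z - σ₁) / δ|) ^ 2
          + |q z - σ₂ - (p z - σ₁) * m z| / γ)) ≤ ENNReal.ofReal (C * (γ ^ (1 / 3 : ℝ) * δ)) ∧
      ∫⁻ z in U, ENNReal.ofReal (|levelDeriv p τ q z - (p z - σ₁) * levelDeriv p τ m z| /
          ((γ * (1 + |(p z - σ₁) / δ|) ^ 2 / 4) ^ 2 + (q z - σ₂ - (p z - σ₁) * m z) ^ 2))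
        ≤ ENNReal.ofReal (C * (δ / γ)) := by
  have hp₀ := hp.self_of_nhds
  have hτ₀ := hτ.self_of_nhds
  obtain ⟨c, hc, hlow⟩ := exists_eventually_lower
    (hp₀.iterate_levelDeriv hτ₀ hq.self_of_nhds hJ 3).continuousAt hX
  obtain ⟨L, hL, hmL⟩ := exists_eventually_abs_le
    (hp₀.iterate_levelDeriv hτ₀ hm.self_of_nhds hJ 3).continuousAt
  set η := c / (4 * L) with hη
  have hη0 : 0 < η := by positivity
  have hJ' : ∀ᶠ z in nhds z₀, jac p τ z ≠ 0 := (hp₀.jac hτ₀).continuousAt.eventually_ne hJ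
  have hpη : ∀ᶠ z in nhds z₀, |p z - p z₀| < η := by
    have := hp₀.continuousAt.eventually (Metric.ball_mem_nhds _ hη0)
    simpa [Real.dist_eq] using this
  have hO : ∃ O ∈ nhds z₀, (∀ z ∈ O, SmoothAt p z) ∧ (∀ z ∈ O, SmoothAt q z) ∧
      (∀ z ∈ O, SmoothAt τ z) ∧ (∀ z ∈ O, SmoothAt m z) ∧ (∀ z ∈ O, jac p τ z ≠ 0) ∧
      (∀ z ∈ O, |(levelDeriv p τ)^[3] m z| ≤ L) ∧ (∀ z ∈ O, |p z - p z₀| < η) ∧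
      ((∀ z ∈ O, c ≤ (levelDeriv p τ)^[3] q z) ∨ (∀ z ∈ O, (levelDeriv p τ)^[3] q z ≤ -c)) := by
    have h0 := hp.and (hq.and (hτ.and (hm.and (hJ'.and (hmL.and hpη)))))
    rcases hlow with hlow | hlow
    · exact ⟨_, h0.and hlow, fun z hz => hz.1.1, fun z hz => hz.1.2.1, fun z hz => hz.1.2.2.1,
        fun z hz => hz.1.2.2.2.1, fun z hz => hz.1.2.2.2.2.1, fun z hz => hz.1.2.2.2.2.2.1,
        fun z hz => hz.1.2.2.2.2.2.2, Or.inl fun z hz => hz.2⟩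
    · exact ⟨_, h0.and hlow, fun z hz => hz.1.1, fun z hz => hz.1.2.1, fun z hz => hz.1.2.2.1,
        fun z hz => hz.1.2.2.2.1, fun z hz => hz.1.2.2.2.2.1, fun z hz => hz.1.2.2.2.2.2.1,
        fun z hz => hz.1.2.2.2.2.2.2, Or.inr fun z hz => hz.2⟩
  obtain ⟨O, hO, hpO, hqO, hτO, hmO, hJO, hLO, hηO, hlO⟩ := hO
  obtain ⟨χ⟩ := nonempty_levelChart hO hpO hτO hJ
  obtain ⟨K, hK, hKle⟩ := exists_lintegral_inv_add_abs_le (k := 3) (by norm_num) (half_pos hc)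
  obtain ⟨K₁, hK₁, hK₁le⟩ := exists_lintegral_one_add_abs_rpow_le (r := 4 / 3) (by norm_num)
  obtain ⟨K₂, hK₂, hK₂le⟩ := exists_lintegral_one_add_abs_rpow_le (r := 2) (by norm_num)
  have hχC := χ.C_pos
  refine ⟨χ.U, χ.U_mem, η, hη0, χ.C * (K * K₁ + 16 * π * K₂), by positivity,
    fun δ hδ γ hγ σ₁ σ₂ hσ => ?_⟩
  have hpw : ∀ {w t : ℝ}, w ∈ Set.Icc (p z₀ - χ.r) (p z₀ + χ.r) →
      t ∈ Set.Icc (τ z₀ - χ.r) (τ z₀ + χ.r) → p (χ.χ (w, t)) = w := fun hw ht =>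
    congrArg Prod.fst (χ.rightInv _ (χ.mem_closedBall hw ht)).self_of_nhds
  set f : ℝ → ℕ → ℝ → ℝ := fun w j t => (levelDeriv p τ)^[j] q (χ.χ (w, t))
    - (if j = 0 then σ₂ else 0) - (w - σ₁) * (levelDeriv p τ)^[j] m (χ.χ (w, t)) with hf
  have hchain : ∀ w ∈ Set.Icc (p z₀ - χ.r) (p z₀ + χ.r),
      DerivChain (f w) 3 (τ z₀ - χ.r) (τ z₀ + χ.r) := by
    intro w hw j _ t ht
    have h1 := (χ.hasDerivAt_iterate hpO hτO hqO hJO (χ.mem_closedBall hw ht) j).sub_const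
      (if j = 0 then σ₂ else 0)
    have h2 := (χ.hasDerivAt_iterate hpO hτO hmO hJO (χ.mem_closedBall hw ht) j).const_mul (w - σ₁)
    exact (h1.sub h2).congr_deriv (by simp [hf])
  have hlower : ∀ w ∈ Set.Icc (p z₀ - χ.r) (p z₀ + χ.r),
      DerivLower (f w) 3 (c / 2) (τ z₀ - χ.r) (τ z₀ + χ.r) := by
    intro w hw
    have hsmall : ∀ t ∈ Set.Icc (τ z₀ - χ.r) (τ z₀ + χ.r),
        |(w - σ₁) * (levelDeriv p τ)^[3] m (χ.χ (w, t))| ≤ c / 2 := by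
      intro t ht
      have hz := χ.mem_O _ (χ.mem_closedBall hw ht)
      have h1 := hηO _ hz
      rw [hpw hw ht] at h1
      have h2 : |w - σ₁| ≤ 2 * η := by
        have := abs_add_le (w - p z₀) (p z₀ - σ₁)
        rw [sub_add_sub_cancel] at this
        linarith
      calc _ = |w - σ₁| * |(levelDeriv p τ)^[3] m (χ.χ (w, t))| := abs_mul _ _
        _ ≤ 2 * η * L := by gcongr; exact hLO _ hz
        _ = c / 2 := by rw [hη]; field_simp; norm_num
    rcases hlO with h | h
    · refine Or.inl fun t ht => ?_
      have h1 := h _ (χ.mem_O _ (χ.mem_closedBall hw ht))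
      have h2 := abs_le.1 (hsmall t ht)
      simp only [hf, OfNat.ofNat_ne_zero, if_false]
      linarith [h2.2]
    · refine Or.inr fun t ht => ?_
      have h1 := h _ (χ.mem_O _ (χ.mem_closedBall hw ht))
      have h2 := abs_le.1 (hsmall t ht)
      simp only [hf, OfNat.ofNat_ne_zero, if_false]
      linarith [h2.1]
  have hτr : τ z₀ - χ.r ≤ τ z₀ + χ.r := by linarith [χ.r_pos]
  constructor
  · refine (χ.setLIntegral_le (B := fun w => ENNReal.ofReal (K * γ ^ (1 / 3 : ℝ)) *
      ENNReal.ofReal ((1 + |(w - σ₁) / δ|) ^ (-(4 / 3) : ℝ))) fun w hw => ?_).trans ?_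
    · set N := 1 + |(w - σ₁) / δ| with hN
      have hN0 : 0 < N := by positivity
      have h1 := hKle (f w) _ _ (γ * N ^ 2) hτr (by positivity) (hchain w hw) (hlower w hw)
      refine (setLIntegral_ofReal_le_of_le measurableSet_Icc hγ.le (fun t ht => ?_) h1).trans_eq ?_
      · rw [hpw hw ht]
        simp only [hf, Function.iterate_zero, id, if_true]
        rw [← hN]
        apply le_of_eq
        field_simp
      · rw [← ENNReal.ofReal_mul (by positivity)]
        congr 1
        rw [mul_rpow hγ.le (by positivity), ← rpow_natCast N 2, ← rpow_mul hN0.le,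
          show ((1 : ℝ) / (3 : ℕ) - 1) = 1 / 3 - 1 by norm_num, rpow_sub_one hγ.ne',
          show ((2 : ℕ) : ℝ) * (1 / 3 - 1) = -(4 / 3) by norm_num]
        field_simp
    · rw [lintegral_const_mul' _ _ ENNReal.ofReal_ne_top]
      refine (mul_le_mul_right (mul_le_mul_right (hK₁le σ₁ δ hδ) _) _).trans ?_
      rw [← ENNReal.ofReal_mul (by positivity), ← ENNReal.ofReal_mul (by positivity)]
      refine ENNReal.ofReal_le_ofReal ?_
      have : 0 ≤ χ.C * (16 * π * K₂) * (γ ^ (1 / 3 : ℝ) * δ) := by positivity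
      linarith
  · refine (χ.setLIntegral_le (B := fun w => ENNReal.ofReal (16 * π / γ) *
      ENNReal.ofReal ((1 + |(w - σ₁) / δ|) ^ (-2 : ℝ))) fun w hw => ?_).trans ?_
    · set N := 1 + |(w - σ₁) / δ| with hN
      have hN0 : 0 < N := by positivity
      have h1 := lintegral_abs_deriv_div_le (M := γ * N ^ 2 / 4) (by norm_num) (half_pos hc).le hτr
        (by positivity) (hchain w hw) (hlower w hw)
      refine (setLIntegral_mono' measurableSet_Icc fun t ht => ?_).trans (h1.trans_eq ?_)
      · rw [hpw hw ht]
        simp [hf, hN]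
      · rw [← ENNReal.ofReal_mul (by positivity), show (2 : ℝ≥0∞) ^ (3 - 1) = ENNReal.ofReal 4 by
          norm_num, ← ENNReal.ofReal_mul (by norm_num), rpow_neg hN0.le, rpow_two]
        congr 1
        field_simp
        norm_num
    · rw [lintegral_const_mul' _ _ ENNReal.ofReal_ne_top]
      refine (mul_le_mul_right (mul_le_mul_right (hK₂le σ₁ δ hδ) _) _).trans ?_
      rw [← ENNReal.ofReal_mul (by positivity), ← ENNReal.ofReal_mul (by positivity)]
      refine ENNReal.ofReal_le_ofReal ?_
      have : 0 ≤ χ.C * (K * K₁) * (δ / γ) := by positivity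
      calc _ = χ.C * (16 * π * K₂) * (δ / γ) := by ring
        _ ≤ _ := by linarith

/-- Integration by parts where the first partial derivative of the phase is bounded below. -/
lemma mul_norm_setIntegral_osc_le_of_lower {Φ : ℝ × ℝ → ℝ} {a b : ℝ × ℝ} (hab : a ≤ b)
    {lam : ℝ} (hlam : 0 ≤ lam) (hΦ : ∀ z ∈ Set.Icc a b, SmoothAt Φ z) {η L : ℝ} (hη : 0 < η)
    (h1 : ∀ z ∈ Set.Icc a b, η ≤ |dx Φ z|) (h2 : ∀ z ∈ Set.Icc a b, |dx (dx Φ) z| ≤ L)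
    (hb1 : b.1 - a.1 ≤ 1) (hb2 : b.2 - a.2 ≤ 1) :
    lam * ‖∫ z in Set.Icc a b, osc lam Φ z‖ ≤ L / η ^ 2 + 2 / η := by
  have hL : 0 ≤ L := (abs_nonneg _).trans (h2 a ⟨le_rfl, hab⟩)
  have hne : ∀ z ∈ Set.Icc a b, dx Φ z ≠ 0 := fun z hz =>
    abs_pos.1 (hη.trans_le (h1 z hz))
  have hA : ∀ z ∈ Set.Icc a b, SmoothAt (fun z => (dx Φ z)⁻¹) z := fun z hz =>
    (hΦ z hz).dx.inv (hne z hz)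
  have hmain := ofReal_mul_norm_setIntegral_osc_le hab hlam hΦ hA (B := fun _ => 0)
    (fun z hz => contDiffAt_const)
  have hI : ∫⁻ z in Set.Icc a b, ENNReal.ofReal (lam * |1 - ((dx Φ z)⁻¹ * dx Φ z
      + 0 * dy Φ z)| + |dx (fun z => (dx Φ z)⁻¹) z + dy (fun _ => (0 : ℝ)) z|)
      ≤ ENNReal.ofReal (L / η ^ 2) := by
    calc _ ≤ ∫⁻ z in Set.Icc a b, ENNReal.ofReal (L / η ^ 2) := by
          refine setLIntegral_mono' measurableSet_Icc fun z hz => ENNReal.ofReal_le_ofReal ?_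
          have e0 : dy (fun _ => (0 : ℝ)) z = 0 := by simp [dy]
          have e1 : dx (fun z => (dx Φ z)⁻¹) z = -dx (dx Φ) z / dx Φ z ^ 2 :=
            (hA z hz).dx_eq (HasDerivAt.inv ((hΦ z hz).dx.hasDerivAt_fst (x := z.1) (y := z.2))
              (hne z hz))
          rw [e0, e1, inv_mul_cancel₀ (hne z hz), abs_of_nonneg (by norm_num)]
          simp only [zero_mul, add_zero, sub_self, mul_zero, zero_add]
          rw [abs_div, abs_neg, abs_pow]
          gcongr
          exacts [h2 z hz, h1 z hz]
      _ = ENNReal.ofReal (L / η ^ 2) * (ENNReal.ofReal (b.1 - a.1) *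
            ENNReal.ofReal (b.2 - a.2)) := by
          rw [setLIntegral_const, Set.Icc_prod_eq, Measure.volume_eq_prod, Measure.prod_prod,
            Real.volume_Icc, Real.volume_Icc]
      _ ≤ ENNReal.ofReal (L / η ^ 2) * (1 * 1) := by
          gcongr <;> exact ENNReal.ofReal_le_one.2 ‹_›
      _ = _ := by simp
  have hE : ∀ x, (∀ y ∈ Set.Icc a.2 b.2, (x, y) ∈ Set.Icc a b) →
      ∫⁻ y in Set.Icc a.2 b.2, ENNReal.ofReal |(dx Φ (x, y))⁻¹| ≤ ENNReal.ofReal (1 / η) := by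
    intro x hx
    calc _ ≤ ∫⁻ y in Set.Icc a.2 b.2, ENNReal.ofReal (1 / η) := by
          refine setLIntegral_mono' measurableSet_Icc fun y hy => ENNReal.ofReal_le_ofReal ?_
          rw [abs_inv, ← one_div]
          gcongr
          exact h1 _ (hx y hy)
      _ = ENNReal.ofReal (1 / η) * ENNReal.ofReal (b.2 - a.2) := by
          rw [setLIntegral_const, Real.volume_Icc]
      _ ≤ ENNReal.ofReal (1 / η) * 1 := by
          gcongr; exact ENNReal.ofReal_le_one.2 hb2
      _ = _ := by simp
  have e3 := hE b.1 fun y hy => ⟨⟨hab.1, hy.1⟩, ⟨le_rfl, hy.2⟩⟩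
  have e4 := hE a.1 fun y hy => ⟨⟨le_rfl, hy.1⟩, ⟨hab.1, hy.2⟩⟩
  have hz : ∀ s : Set ℝ, ∫⁻ _ in s, ENNReal.ofReal |(0 : ℝ)| ≤ ENNReal.ofReal 0 := by simp
  have htot := hmain.trans (add_le_add (add_le_add (add_le_add (add_le_add hI (hz _)) (hz _)) e3)
    e4)
  rw [← ENNReal.ofReal_add (by positivity) (by positivity),
    ← ENNReal.ofReal_add (by positivity) (by positivity),
    ← ENNReal.ofReal_add (by positivity) (by positivity),
    ← ENNReal.ofReal_add (by positivity) (by positivity),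
    ENNReal.ofReal_le_ofReal_iff (by positivity)] at htot
  refine htot.trans_eq ?_
  ring

lemma one_div_quartic_le (α β : ℝ) :
    1 / (1 + α ^ 4 + β ^ 2) ≤ 4 / ((1 + |α|) ^ 2 + |β|) := by
  rw [div_le_div_iff₀ (by positivity) (by positivity), ← sq_abs β,
    ← Even.pow_abs (by decide : Even 4) α]
  nlinarith [sq_nonneg (|α| - 1), sq_nonneg (|β| - 1), sq_nonneg (|α| ^ 2 - 1)]

lemma sq_div_quartic_le (α β : ℝ) :
    α ^ 2 / (1 + α ^ 4 + β ^ 2) ≤ 4 / ((1 + |α|) ^ 2 + |β|) := by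
  rw [div_le_div_iff₀ (by positivity) (by positivity), ← sq_abs β,
    ← Even.pow_abs (by decide : Even 4) α, ← sq_abs α]
  nlinarith [sq_nonneg (|α| ^ 2 - |α|), sq_nonneg (|α| ^ 2 - |β|), sq_nonneg (|α| ^ 2 - 1),
    sq_nonneg |α|]

lemma abs_div_quartic_le (α β : ℝ) :
    |β| / (1 + α ^ 4 + β ^ 2) ≤ 4 / ((1 + |α|) ^ 2 + |β|) := by
  rw [div_le_div_iff₀ (by positivity) (by positivity), ← sq_abs β,
    ← Even.pow_abs (by decide : Even 4) α]
  nlinarith [sq_nonneg (|β| - 1), sq_nonneg (|α| ^ 2 - |β|),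
    mul_nonneg (abs_nonneg β) (sq_nonneg (|α| - 1))]

/-- Bound for the divergence of the vector field `(α³/(δQ) - mβ/(γQ), β/(γQ))` with
`Q = 1 + α⁴ + β²`. -/
lemma abs_div_field_le {α β m px mx δ γ G L Q Qx Qy αx αy βx βy : ℝ} (hδ : 0 < δ) (hγ : 0 < γ)
    (hγδ : δ ^ 2 ≤ γ) (hL : 0 ≤ L) (hQ : Q = 1 + α ^ 4 + β ^ 2)
    (hQx : Qx = 4 * α ^ 3 * αx + 2 * β * βx) (hQy : Qy = 4 * α ^ 3 * αy + 2 * β * βy)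
    (hαx : αx = px / δ) (hαy : αy = m * αx) (hβx : βx = -(mx * α * δ) / γ)
    (hβy : βy = m * βx + G / γ) (h1 : |px| ≤ L) (h2 : |mx| ≤ L) :
    |((3 * α ^ 2 * αx * (δ * Q) - α ^ 3 * (δ * Qx)) / (δ * Q) ^ 2
        - (mx * (β / (γ * Q)) + m * ((βx * (γ * Q) - β * (γ * Qx)) / (γ * Q) ^ 2)))
      + (βy * (γ * Q) - β * (γ * Qy)) / (γ * Q) ^ 2|
      ≤ 40 * L / δ ^ 2 * (1 / ((1 + |α|) ^ 2 + |β|)) + |G| / (γ ^ 2 * Q) := by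
  have hQ0 : 0 < Q := by rw [hQ]; positivity
  have hα4 : α ^ 4 ≤ Q := by rw [hQ]; nlinarith [sq_nonneg β]
  have hβ2 : β ^ 2 ≤ Q := by rw [hQ]; nlinarith [sq_nonneg (α ^ 2)]
  have key : ((3 * α ^ 2 * αx * (δ * Q) - α ^ 3 * (δ * Qx)) / (δ * Q) ^ 2
        - (mx * (β / (γ * Q)) + m * ((βx * (γ * Q) - β * (γ * Qx)) / (γ * Q) ^ 2)))
      + (βy * (γ * Q) - β * (γ * Qy)) / (γ * Q) ^ 2
      = (px / δ ^ 2 * ((3 - 4 * (α ^ 4 / Q)) * (α ^ 2 / Q)) +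
        mx / γ * ((2 * (α ^ 4 / Q) - 1) * (β / Q))) +
        G / (γ ^ 2 * Q) * (1 - 2 * (β ^ 2 / Q)) := by
    rw [hβy, hQx, hQy, hαy, hβx, hαx, hβy, hβx]
    field_simp
    ring
  rw [key]
  have u0 : 0 ≤ α ^ 4 / Q := by positivity
  have u1 : α ^ 4 / Q ≤ 1 := div_le_one_of_le₀ hα4 hQ0.le
  have w0 : 0 ≤ β ^ 2 / Q := by positivity
  have w1 : β ^ 2 / Q ≤ 1 := div_le_one_of_le₀ hβ2 hQ0.le
  have s1 : α ^ 2 / Q ≤ 4 / ((1 + |α|) ^ 2 + |β|) := hQ ▸ sq_div_quartic_le α β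
  have s2 : |β| / Q ≤ 4 / ((1 + |α|) ^ 2 + |β|) := hQ ▸ abs_div_quartic_le α β
  refine (abs_add_le _ _).trans (add_le_add ((abs_add_le _ _).trans ?_) ?_)
  · have t1 : |px / δ ^ 2 * ((3 - 4 * (α ^ 4 / Q)) * (α ^ 2 / Q))|
        ≤ L / δ ^ 2 * (7 * (4 / ((1 + |α|) ^ 2 + |β|))) := by
      rw [abs_mul, abs_mul, abs_div, abs_of_pos (by positivity : 0 < δ ^ 2),
        abs_of_nonneg (by positivity : 0 ≤ α ^ 2 / Q)]
      gcongr
      rw [abs_le]; constructor <;> linarith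
    have t2 : |mx / γ * ((2 * (α ^ 4 / Q) - 1) * (β / Q))|
        ≤ L / δ ^ 2 * (3 * (4 / ((1 + |α|) ^ 2 + |β|))) := by
      rw [abs_mul, abs_mul, abs_div, abs_of_pos hγ, abs_div β, abs_of_pos hQ0]
      gcongr
      rw [abs_le]; constructor <;> linarith
    refine (add_le_add t1 t2).trans_eq ?_
    ring
  · rw [abs_mul, abs_div, abs_of_pos (by positivity : 0 < γ ^ 2 * Q)]
    refine mul_le_of_le_one_right (by positivity) ?_
    rw [abs_le]; constructor <;> linarith

lemma quartic_lower {α β γ : ℝ} :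
    (γ * (1 + |α|) ^ 2 / 4) ^ 2 + (γ * β) ^ 2 ≤ γ ^ 2 * (1 + α ^ 4 + β ^ 2) := by
  have : (1 + |α|) ^ 4 ≤ 16 * (1 + α ^ 4) := by
    rw [← Even.pow_abs (by decide : Even 4) α]
    nlinarith [sq_nonneg (|α| - 1), sq_nonneg (|α| ^ 2 - 1), sq_nonneg (|α| ^ 2 - |α|)]
  nlinarith [mul_le_mul_of_nonneg_left this (sq_nonneg γ)]

lemma abs_cube_div_le {α β δ v : ℝ} (hδ : 0 < δ) (hα : α = v / δ) :
    |α ^ 3 / (δ * (1 + α ^ 4 + β ^ 2))| ≤ 2 * (1 / (δ + |v|)) := by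
  have hv : |v| = δ * |α| := by rw [hα, abs_div, abs_of_pos hδ]; field_simp
  rw [hv, abs_div, abs_of_pos (by positivity : 0 < δ * (1 + α ^ 4 + β ^ 2)), abs_pow, mul_one_div,
    div_le_div_iff₀ (by positivity) (by positivity), ← Even.pow_abs (by decide : Even 4) α]
  have h : |α| ^ 3 * (1 + |α|) ≤ 2 * (1 + |α| ^ 4 + β ^ 2) := by
    nlinarith [sq_nonneg (|α| - 1), sq_nonneg (|α| ^ 2 - 1), sq_nonneg (|α| ^ 2 - |α|),
      sq_nonneg β]
  nlinarith [mul_le_mul_of_nonneg_left h hδ.le]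

lemma abs_div_quartic_le_rpow {α β γ : ℝ} (hγ : 0 < γ) :
    |β / (γ * (1 + α ^ 4 + β ^ 2))| ≤ 2 / γ * (1 + |α|) ^ (-2 : ℝ) := by
  rw [rpow_neg (by positivity), rpow_two, ← div_eq_mul_inv, div_div, abs_div,
    abs_of_pos (by positivity : 0 < γ * (1 + α ^ 4 + β ^ 2)),
    div_le_div_iff₀ (by positivity) (by positivity), ← Even.pow_abs (by decide : Even 4) α,
    ← sq_abs β]
  have h : |β| * (1 + |α|) ^ 2 ≤ 2 * (1 + |α| ^ 4 + |β| ^ 2) := by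
    nlinarith [sq_nonneg (|β| - 1), sq_nonneg (|α| ^ 2 - |β|),
      mul_nonneg (abs_nonneg β) (sq_nonneg (|α| - 1))]
  nlinarith [mul_le_mul_of_nonneg_left h hγ.le]

lemma jac_snd (p : ℝ × ℝ → ℝ) (z : ℝ × ℝ) : jac p Prod.snd z = dx p z := by
  simp [jac, dx, dy, fderiv_snd]

lemma jac_fst (p : ℝ × ℝ → ℝ) (z : ℝ × ℝ) : jac p Prod.fst z = -dy p z := by
  simp [jac, dx, dy, fderiv_fst]

/-- Decay at a point where the gradient map has a cusp-like degeneracy: the third derivative of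
one partial derivative along the level curves of the other does not vanish. -/
theorem localDecay_of_third_levelDeriv_ne_zero {W : ℝ × ℝ → ℝ} {z₀ : ℝ × ℝ}
    (hW : ∀ᶠ z in nhds z₀, SmoothAt W z) (hsymm : ∀ᶠ z in nhds z₀, dy (dx W) z = dx (dy W) z)
    (hx : dx (dx W) z₀ ≠ 0) (hy : dy (dx W) z₀ ≠ 0)
    (hX : (levelDeriv (dx W) Prod.snd)^[3] (dy W) z₀ ≠ 0) : LocalDecay W z₀ := by
  have hW₀ := hW.self_of_nhds
  have hp : ∀ᶠ z in nhds z₀, SmoothAt (dx W) z := hW.mono fun z h => h.dx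
  have hq : ∀ᶠ z in nhds z₀, SmoothAt (dy W) z := hW.mono fun z h => h.dy
  have hne : ∀ᶠ z in nhds z₀, dx (dx W) z ≠ 0 := hW₀.dx.dx.continuousAt.eventually_ne hx
  set m : ℝ × ℝ → ℝ := fun z => dy (dx W) z / dx (dx W) z with hm
  have hms : ∀ᶠ z in nhds z₀, SmoothAt m z :=
    (hp.and hne).mono fun z h => h.1.dy.div h.1.dx h.2
  obtain ⟨U₁, hU₁, K₁, hK₁, H₁⟩ := exists_lintegral_vertical_le hp (Or.inl hy)
  obtain ⟨U₂, hU₂, K₂, hK₂, H₂⟩ := exists_lintegral_line_comp_le (e := fun y x => (x, y))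
    (f := dx W) (f' := dx (dx W)) (hp.mono fun z h y x hz => by
      subst hz; exact h.hasDerivAt_fst) hW₀.dx.dx.continuousAt hx
  obtain ⟨U₃, hU₃, K₃, hK₃, H₃⟩ := exists_lintegral_line_comp_le (e := fun x y => (x, y))
    (f := dx W) (f' := dy (dx W)) (hp.mono fun z h y x hz => by
      subst hz; exact h.hasDerivAt_snd) hW₀.dx.dy.continuousAt hy
  obtain ⟨U₄, hU₄, η, hη, C, hC, H₄⟩ := exists_lintegral_third_le (τ := Prod.snd) hp hq
    (Filter.Eventually.of_forall fun z => smoothAt_snd) hms (by rwa [jac_snd]) hX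
  obtain ⟨L₁, hL₁, B₁⟩ := exists_eventually_abs_le hW₀.dx.dx.continuousAt
  obtain ⟨L₂, hL₂, B₂⟩ := exists_eventually_abs_le hms.self_of_nhds.dx.continuousAt
  obtain ⟨M, hM, B₃⟩ := exists_eventually_abs_le hms.self_of_nhds.continuousAt
  have hnear : ∀ᶠ z in nhds z₀, |dx W z - dx W z₀| ≤ η / 2 := by
    have : Filter.Tendsto (fun z => |dx W z - dx W z₀|) (nhds z₀) (nhds 0) := by
      simpa using (hW₀.dx.continuousAt.sub_const (dx W z₀)).abs
    exact this.eventually (ge_mem_nhds (half_pos hη))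
  set L := L₁ + L₂ with hL
  refine ⟨U₁ ∩ (U₂ ∩ (U₃ ∩ (U₄ ∩ (Metric.ball z₀ (1 / 2) ∩ {z | SmoothAt W z ∧
    dy (dx W) z = dx (dy W) z ∧ dx (dx W) z ≠ 0 ∧ SmoothAt m z ∧ |dx (dx W) z| ≤ L₁ ∧
    |dx m z| ≤ L₂ ∧ |m z| ≤ M ∧ |dx W z - dx W z₀| ≤ η / 2 ∧ ∀ᶠ w in nhds z, SmoothAt W w})))),
    Filter.inter_mem hU₁ (Filter.inter_mem hU₂ (Filter.inter_mem hU₃ (Filter.inter_mem hU₄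
      (Filter.inter_mem (Metric.ball_mem_nhds _ (by norm_num)) (hW.and (hsymm.and (hne.and
        (hms.and (B₁.and (B₂.and (B₃.and (hnear.and hW.eventually_nhds)))))))))))),
    (L / (η / 2) ^ 2 + 2 / (η / 2)) + ((4 + 40 * L) * C + C + 4 * K₂ + 4 * K₁ + 4 * M * K₃),
    by positivity, ?_⟩
  intro a b hab hsub lam hlam σ₁ σ₂
  have hlam0 : 0 < lam := by linarith
  refine le_mul_rpow_of_mul_le hlam0 ?_
  have hr1 : 1 ≤ lam ^ (1 / 4 : ℝ) := one_le_rpow hlam (by norm_num)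
  have hΦs : ∀ z ∈ Set.Icc a b, SmoothAt (tilt W σ₁ σ₂) z := fun z hz =>
    (hsub hz).2.2.2.2.2.1.tilt σ₁ σ₂
  by_cases hres : |dx W z₀ - σ₁| ≤ η
  swap
  · have hside : dist b a ≤ 1 := by
      have h1 := (hsub (Set.right_mem_Icc.2 hab)).2.2.2.2.1
      have h2 := (hsub (Set.left_mem_Icc.2 hab)).2.2.2.2.1
      rw [Metric.mem_ball] at h1 h2
      linarith [dist_triangle_right b a z₀]
    rw [Prod.dist_eq, max_le_iff, Real.dist_eq, Real.dist_eq] at hside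
    have hev : ∀ z ∈ Set.Icc a b, dx (tilt W σ₁ σ₂) =ᶠ[nhds z] fun z => dx W z - σ₁ := by
      intro z hz
      filter_upwards [(hsub hz).2.2.2.2.2.2.2.2.2.2.2.2.2] with w hw
      exact SmoothAt.dx_tilt hw σ₁ σ₂
    have := mul_norm_setIntegral_osc_le_of_lower hab hlam0.le hΦs (half_pos hη) (L := L)
      (fun z hz => by
        obtain ⟨-, -, -, -, -, hWz, -, -, -, -, -, -, h, -⟩ := hsub hz
        rw [hWz.dx_tilt]
        have := abs_sub_abs_le_abs_sub (dx W z₀ - σ₁) (dx W z₀ - dx W z)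
        rw [abs_sub_comm (dx W z₀) (dx W z)] at this
        rw [show dx W z₀ - σ₁ - (dx W z₀ - dx W z) = dx W z - σ₁ by ring] at this
        linarith [not_le.1 hres])
      (fun z hz => by
        obtain ⟨-, -, -, -, -, hWz, -, -, -, h, -⟩ := hsub hz
        have h1 : dx (dx (tilt W σ₁ σ₂)) z = dx (dx W) z := by
          rw [dx, (hev z hz).fderiv_eq, fderiv_sub_const]; rfl
        rw [h1]; linarith)
      (le_trans (le_abs_self _) hside.1) (le_trans (le_abs_self _) hside.2)
    refine this.trans ?_
    have hpos : 0 ≤ (L / (η / 2) ^ 2 + 2 / (η / 2))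
        + ((4 + 40 * L) * C + C + 4 * K₂ + 4 * K₁ + 4 * M * K₃) := by positivity
    refine le_trans ?_ (le_mul_of_one_le_right hpos hr1)
    exact le_add_of_nonneg_right (by positivity)
  set δ := lam ^ (-(1 / 2) : ℝ) with hδ
  set γ := lam ^ (-(3 / 4) : ℝ) with hγ
  have hδ0 : 0 < δ := rpow_pos_of_pos hlam0 _
  have hγ0 : 0 < γ := rpow_pos_of_pos hlam0 _
  have hδ2 : lam = 1 / δ ^ 2 := by
    rw [hδ, ← rpow_natCast, ← rpow_mul hlam0.le]; norm_num
    rw [rpow_neg_one, inv_inv]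
  have hδ2' : δ ^ 2 = lam ^ (-1 : ℝ) := by
    rw [hδ, ← rpow_natCast, ← rpow_mul hlam0.le]; norm_num
  have hγδ : δ ^ 2 ≤ γ := by
    rw [hδ2', hγ]
    exact rpow_le_rpow_of_exponent_le hlam (by norm_num)
  have hδr : δ ^ (-(1 / 2) : ℝ) = lam ^ (1 / 4 : ℝ) := by
    rw [hδ, ← rpow_mul hlam0.le]; norm_num
  have hδγ : δ / γ = lam ^ (1 / 4 : ℝ) := by
    rw [hδ, hγ, ← rpow_sub hlam0]; norm_num
  have hγ3 : γ ^ (1 / 3 : ℝ) * δ / δ ^ 2 = lam ^ (1 / 4 : ℝ) := by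
    rw [hδ2', hγ, hδ, ← rpow_mul hlam0.le, ← rpow_add hlam0, ← rpow_sub hlam0]; norm_num
  set α : ℝ × ℝ → ℝ := fun z => (dx W z - σ₁) / δ with hα
  set β : ℝ × ℝ → ℝ := fun z => (dy W z - σ₂ - (dx W z - σ₁) * m z) / γ with hβ
  set Q : ℝ × ℝ → ℝ := fun z => 1 + α z ^ 4 + β z ^ 2 with hQ
  have hQ0 : ∀ z, 0 < Q z := fun z => by simp only [hQ]; positivity
  have hWs : ∀ z ∈ Set.Icc a b, SmoothAt W z := fun z hz => (hsub hz).2.2.2.2.2.1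
  have hmz : ∀ z ∈ Set.Icc a b, SmoothAt m z := fun z hz => (hsub hz).2.2.2.2.2.2.2.2.1
  have hαs : ∀ z ∈ Set.Icc a b, SmoothAt α z := fun z hz =>
    ((hWs z hz).dx.sub contDiffAt_const).div_const δ
  have hβs : ∀ z ∈ Set.Icc a b, SmoothAt β z := fun z hz =>
    (((hWs z hz).dy.sub contDiffAt_const).sub
      (((hWs z hz).dx.sub contDiffAt_const).mul (hmz z hz))).div_const γ
  have hQs : ∀ z ∈ Set.Icc a b, SmoothAt Q z := fun z hz =>
    (contDiffAt_const.add ((hαs z hz).pow 4)).add ((hβs z hz).pow 2)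
  have hBs : ∀ z ∈ Set.Icc a b, SmoothAt (fun z => β z / (γ * Q z)) z := fun z hz =>
    (hβs z hz).div (contDiffAt_const.mul (hQs z hz)) (mul_pos hγ0 (hQ0 z)).ne'
  have hAs : ∀ z ∈ Set.Icc a b, SmoothAt
      (fun z => α z ^ 3 / (δ * Q z) - m z * (β z / (γ * Q z))) z := fun z hz =>
    (((hαs z hz).pow 3).div (contDiffAt_const.mul (hQs z hz)) (mul_pos hδ0 (hQ0 z)).ne').sub
      ((hmz z hz).mul (hBs z hz))
  have hcont : ∀ {F : ℝ × ℝ → ℝ}, (∀ z ∈ Set.Icc a b, SmoothAt F z) →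
      ContinuousOn F (Set.Icc a b) := fun h z hz => (h z hz).continuousAt.continuousWithinAt
  have hmain := ofReal_mul_norm_setIntegral_osc_le hab hlam0.le hΦs hAs hBs
  obtain ⟨I₁, I₂⟩ := H₄ δ hδ0 γ hγ0 σ₁ σ₂ hres
  set G : ℝ × ℝ → ℝ := fun z => levelDeriv (dx W) Prod.snd (dy W) z
    - (dx W z - σ₁) * levelDeriv (dx W) Prod.snd m z with hG
  have hI : ∫⁻ z in Set.Icc a b, ENNReal.ofReal (lam * |1 -
      ((α z ^ 3 / (δ * Q z) - m z * (β z / (γ * Q z))) * dx (tilt W σ₁ σ₂) z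
      + β z / (γ * Q z) * dy (tilt W σ₁ σ₂) z)|
      + |dx (fun z => α z ^ 3 / (δ * Q z) - m z * (β z / (γ * Q z))) z
        + dy (fun z => β z / (γ * Q z)) z|)
      ≤ ENNReal.ofReal ((4 + 40 * L) / δ ^ 2 * (C * (γ ^ (1 / 3 : ℝ) * δ)) + C * (δ / γ)) := by
    have J₁ := setLIntegral_ofReal_le_of_le (μ := volume) (S := Set.Icc a b) measurableSet_Icc
      (f := fun z => (4 + 40 * L) / δ ^ 2 * (1 / ((1 + |α z|) ^ 2 + |β z|)))
      (by positivity : 0 ≤ (4 + 40 * L) / δ ^ 2) (fun z hz => le_rfl)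
      (B := C * (γ ^ (1 / 3 : ℝ) * δ)) (by
        refine le_trans (le_of_eq ?_) ((lintegral_mono_set fun z hz => (hsub hz).2.2.2.1).trans I₁)
        simp only [hβ, hα, abs_div, abs_of_pos hγ0])
    have J₂ := setLIntegral_ofReal_le_of_le (μ := volume) (S := Set.Icc a b) measurableSet_Icc
      (f := fun z => |G z| / (γ ^ 2 * Q z)) (g := fun z => |G z| /
          ((γ * (1 + |α z|) ^ 2 / 4) ^ 2 + (γ * β z) ^ 2)) zero_le_one (fun z hz => by
        rw [one_mul]
        exact div_le_div_of_nonneg_left (abs_nonneg (G z)) (by positivity)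
          quartic_lower) (B := C * (δ / γ)) (by
        refine le_trans (le_of_eq ?_) ((lintegral_mono_set fun z hz => (hsub hz).2.2.2.1).trans I₂)
        simp only [hβ, hα, hG, mul_div_cancel₀ _ hγ0.ne'])
    rw [one_mul] at J₂
    rw [ENNReal.ofReal_add (by positivity) (by positivity)]
    refine le_trans ?_ (add_le_add J₁ J₂)
    rw [← lintegral_add_left']
    · refine setLIntegral_mono' measurableSet_Icc fun z hz => ?_
      rw [← ENNReal.ofReal_add (by positivity) (by have := hQ0 z; positivity)]
      refine ENNReal.ofReal_le_ofReal ?_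
      obtain ⟨-, -, -, -, -, hWz, hs, hn, hmz', b1, b2, b3, -⟩ := hsub hz
      have e1 : lam * |1 - ((α z ^ 3 / (δ * Q z) - m z * (β z / (γ * Q z))) * dx (tilt W σ₁ σ₂) z
          + β z / (γ * Q z) * dy (tilt W σ₁ σ₂) z)|
          ≤ 4 / δ ^ 2 * (1 / ((1 + |α z|) ^ 2 + |β z|)) := by
        have hv : dx W z - σ₁ = δ * α z := by simp only [hα]; field_simp
        have hh : dy W z - σ₂ = γ * β z + δ * α z * m z := by
          rw [← hv]; simp only [hβ]; field_simp; ring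
        rw [hWz.dx_tilt, hWz.dy_tilt, hv, hh]
        have : 1 - ((α z ^ 3 / (δ * Q z) - m z * (β z / (γ * Q z))) * (δ * α z)
            + β z / (γ * Q z) * (γ * β z + δ * α z * m z)) = 1 / Q z := by
          have := (hQ0 z).ne'
          field_simp
          simp only [hQ]; ring
        rw [this, abs_of_pos (one_div_pos.2 (hQ0 z)), hδ2, div_mul_eq_mul_div, one_mul,
          div_mul_eq_mul_div, mul_one_div]
        exact div_le_div_of_nonneg_right (one_div_quartic_le _ _) (by positivity)
      have e2 : |dx (fun z => α z ^ 3 / (δ * Q z) - m z * (β z / (γ * Q z))) z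
          + dy (fun z => β z / (γ * Q z)) z|
          ≤ 40 * L / δ ^ 2 * (1 / ((1 + |α z|) ^ 2 + |β z|)) + |G z| / (γ ^ 2 * Q z) := by
        have p1 := hWz.dx.hasDerivAt_fst (x := z.1) (y := z.2)
        have q1 := hWz.dy.hasDerivAt_fst (x := z.1) (y := z.2)
        have m1 := hmz'.hasDerivAt_fst (x := z.1) (y := z.2)
        have p2 := hWz.dx.hasDerivAt_snd (x := z.1) (y := z.2)
        have q2 := hWz.dy.hasDerivAt_snd (x := z.1) (y := z.2)
        have m2 := hmz'.hasDerivAt_snd (x := z.1) (y := z.2)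
        obtain ⟨αx, hαx⟩ : ∃ t, t = dx (dx W) z / δ := ⟨_, rfl⟩
        obtain ⟨αy, hαy⟩ : ∃ t, t = dy (dx W) z / δ := ⟨_, rfl⟩
        obtain ⟨βx, hβx⟩ : ∃ t, t = (dx (dy W) z - (dx (dx W) z * m z
          + (dx W z - σ₁) * dx m z)) / γ := ⟨_, rfl⟩
        obtain ⟨βy, hβy⟩ : ∃ t, t = (dy (dy W) z - (dy (dx W) z * m z
          + (dx W z - σ₁) * dy m z)) / γ := ⟨_, rfl⟩
        obtain ⟨Qx, hQx⟩ : ∃ t, t = 4 * α z ^ 3 * αx + 2 * β z * βx := ⟨_, rfl⟩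
        obtain ⟨Qy, hQy⟩ : ∃ t, t = 4 * α z ^ 3 * αy + 2 * β z * βy := ⟨_, rfl⟩
        have a1 : HasDerivAt (fun x => α (x, z.2)) αx z.1 := by
          rw [hαx]; exact (p1.sub_const σ₁).div_const δ
        have a2 : HasDerivAt (fun y => α (z.1, y)) αy z.2 := by
          rw [hαy]; exact (p2.sub_const σ₁).div_const δ
        have b1 : HasDerivAt (fun x => β (x, z.2)) βx z.1 := by
          rw [hβx]; exact ((q1.sub_const σ₂).sub ((p1.sub_const σ₁).mul m1)).div_const γ
        have b2 : HasDerivAt (fun y => β (z.1, y)) βy z.2 := by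
          rw [hβy]; exact ((q2.sub_const σ₂).sub ((p2.sub_const σ₁).mul m2)).div_const γ
        have Q1 : HasDerivAt (fun x => Q (x, z.2)) Qx z.1 :=
          (((a1.pow 4).const_add 1).add (b1.pow 2)).congr_deriv (by rw [hQx]; norm_num)
        have Q2 : HasDerivAt (fun y => Q (z.1, y)) Qy z.2 :=
          (((a2.pow 4).const_add 1).add (b2.pow 2)).congr_deriv (by rw [hQy]; norm_num)
        have A1 : HasDerivAt (fun x => α (x, z.2) ^ 3 / (δ * Q (x, z.2))
            - m (x, z.2) * (β (x, z.2) / (γ * Q (x, z.2))))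
            ((3 * α z ^ 2 * αx * (δ * Q z) - α z ^ 3 * (δ * Qx)) / (δ * Q z) ^ 2
              - (dx m z * (β z / (γ * Q z))
                + m z * ((βx * (γ * Q z) - β z * (γ * Qx)) / (γ * Q z) ^ 2))) z.1 :=
          (((a1.pow 3).div (Q1.const_mul δ) (mul_pos hδ0 (hQ0 z)).ne').sub
            (m1.mul (b1.div (Q1.const_mul γ) (mul_pos hγ0 (hQ0 z)).ne'))).congr_deriv
            (by norm_num)
        have B2 := b2.div (Q2.const_mul γ) (mul_pos hγ0 (hQ0 z)).ne'
        rw [(hAs z hz).dx_eq A1, (hBs z hz).dy_eq B2]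
        have hpm : dy (dx W) z = m z * dx (dx W) z := by simp only [hm]; field_simp
        refine abs_div_field_le hδ0 hγ0 hγδ (by positivity) rfl hQx hQy hαx ?_ ?_ ?_
          (by linarith) (by linarith)
        · rw [hαy, hαx, hpm]; ring
        · rw [hβx, ← hs, hpm]; simp only [hα]; field_simp; ring
        · simp only [hG, levelDeriv, jac_snd]
          unfold jac
          rw [hβy, hβx, ← hs, hpm]
          field_simp
          ring
      calc _ ≤ 4 / δ ^ 2 * (1 / ((1 + |α z|) ^ 2 + |β z|))
            + (40 * L / δ ^ 2 * (1 / ((1 + |α z|) ^ 2 + |β z|)) + |G z| / (γ ^ 2 * Q z)) :=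
            add_le_add e1 e2
        _ = _ := by ring
    · refine ContinuousOn.aemeasurable ?_ measurableSet_Icc
      refine ENNReal.continuous_ofReal.comp_continuousOn (continuousOn_const.mul
        (continuousOn_const.div (((continuousOn_const.add (hcont hαs).abs).pow 2).add
          (hcont hβs).abs) fun z _ => ?_))
      positivity
  have hx' : ∀ y, (∀ x ∈ Set.Icc a.1 b.1, (x, y) ∈ Set.Icc a b) →
      ∫⁻ x in Set.Icc a.1 b.1, ENNReal.ofReal |β (x, y) / (γ * Q (x, y))|
        ≤ ENNReal.ofReal (2 / γ * (K₂ * δ)) := fun y hy =>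
    setLIntegral_ofReal_le_of_le measurableSet_Icc (by positivity)
      (fun x hx => abs_div_quartic_le_rpow hγ0)
      (H₂ a.1 b.1 y (fun x hx => (hsub (hy x hx)).2.1) δ hδ0 σ₁)
  have hy' : ∀ x, (∀ y ∈ Set.Icc a.2 b.2, (x, y) ∈ Set.Icc a b) →
      ∫⁻ y in Set.Icc a.2 b.2, ENNReal.ofReal |α (x, y) ^ 3 / (δ * Q (x, y))
        - m (x, y) * (β (x, y) / (γ * Q (x, y)))|
        ≤ ENNReal.ofReal (2 * (K₁ * δ ^ (-(1 / 2) : ℝ)) + M * (2 / γ) * (K₃ * δ)) := by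
    intro x hx
    have J₁ := setLIntegral_ofReal_le_of_le measurableSet_Icc zero_le_two
      (fun y hy => abs_cube_div_le (β := β (x, y)) (v := dx W (x, y) - σ₁) hδ0 rfl)
      (H₁ a.2 b.2 x hab.2 (fun y hy => (hsub (hx y hy)).1) δ hδ0 σ₁)
    have J₂ := setLIntegral_ofReal_le_of_le (f := fun y => |m (x, y) * (β (x, y) / (γ * Q (x, y)))|)
      measurableSet_Icc (c := M * (2 / γ)) (by positivity)
      (fun y hy => by
        rw [abs_mul, mul_assoc]
        exact mul_le_mul (hsub (hx y hy)).2.2.2.2.2.2.2.2.2.2.2.1 (abs_div_quartic_le_rpow hγ0)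
          (abs_nonneg _) hM.le)
      (H₃ a.2 b.2 x (fun y hy => (hsub (hx y hy)).2.2.1) δ hδ0 σ₁)
    rw [ENNReal.ofReal_add (by positivity) (by positivity)]
    refine le_trans ?_ (add_le_add J₁ J₂)
    rw [← lintegral_add_right']
    · refine lintegral_mono fun y => ?_
      rw [← ENNReal.ofReal_add (abs_nonneg _) (abs_nonneg _)]
      exact ENNReal.ofReal_le_ofReal (abs_sub _ _)
    · exact (ENNReal.continuous_ofReal.comp_continuousOn (((hcont hmz).mul
        (hcont hBs)).abs.comp (Continuous.prodMk_right x).continuousOn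
          fun y hy => hx y hy)).aemeasurable measurableSet_Icc
  have e1 := hx' b.2 fun x hx => ⟨⟨hx.1, hab.2⟩, ⟨hx.2, le_rfl⟩⟩
  have e2 := hx' a.2 fun x hx => ⟨⟨hx.1, le_rfl⟩, ⟨hx.2, hab.2⟩⟩
  have e3 := hy' b.1 fun y hy => ⟨⟨hab.1, hy.1⟩, ⟨le_rfl, hy.2⟩⟩
  have e4 := hy' a.1 fun y hy => ⟨⟨le_rfl, hy.1⟩, ⟨hab.1, hy.2⟩⟩
  have htot := hmain.trans (add_le_add (add_le_add (add_le_add (add_le_add hI e1) e2) e3) e4)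
  have hr : 0 < lam ^ (1 / 4 : ℝ) := rpow_pos_of_pos hlam0 _
  rw [← ENNReal.ofReal_add (by positivity) (by positivity),
    ← ENNReal.ofReal_add (by positivity) (by positivity),
    ← ENNReal.ofReal_add (by positivity) (by positivity),
    ← ENNReal.ofReal_add (by positivity) (by positivity),
    ENNReal.ofReal_le_ofReal_iff (by positivity)] at htot
  rw [hδr] at htot
  refine htot.trans ?_
  have f1 : (4 + 40 * L) / δ ^ 2 * (C * (γ ^ (1 / 3 : ℝ) * δ))
      = (4 + 40 * L) * C * lam ^ (1 / 4 : ℝ) := by rw [← hγ3]; ring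
  have f2 : 2 / γ * (K₂ * δ) = 2 * K₂ * lam ^ (1 / 4 : ℝ) := by rw [← hδγ]; ring
  have f3 : M * (2 / γ) * (K₃ * δ) = 2 * M * K₃ * lam ^ (1 / 4 : ℝ) := by rw [← hδγ]; ring
  rw [f1, f2, f3, hδγ]
  have : 0 ≤ (L / (η / 2) ^ 2 + 2 / (η / 2)) * lam ^ (1 / 4 : ℝ) := by positivity
  linarith

lemma levelDeriv_mul {p τ f g : ℝ × ℝ → ℝ} {z : ℝ × ℝ} (hf : SmoothAt f z) (hg : SmoothAt g z) :
    levelDeriv p τ (fun z => f z * g z) z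
      = levelDeriv p τ f z * g z + f z * levelDeriv p τ g z := by
  have h := hf.hasFDerivAt.fun_mul hg.hasFDerivAt
  simp only [levelDeriv, jac, dx, dy, h.fderiv, add_apply, smul_apply, smul_eq_mul]
  ring

lemma levelDeriv_add {p τ f g : ℝ × ℝ → ℝ} {z : ℝ × ℝ} (hf : SmoothAt f z) (hg : SmoothAt g z) :
    levelDeriv p τ (fun z => f z + g z) z = levelDeriv p τ f z + levelDeriv p τ g z := by
  have h := hf.hasFDerivAt.fun_add hg.hasFDerivAt
  simp only [levelDeriv, jac, dx, dy, h.fderiv, add_apply]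
  ring

lemma levelDeriv_congr {p τ f g : ℝ × ℝ → ℝ} {z : ℝ × ℝ} (h : f =ᶠ[nhds z] g) :
    levelDeriv p τ f z = levelDeriv p τ g z := by
  simp only [levelDeriv, jac, dx, dy, h.fderiv_eq]

/-- The planar dispersion relation on `ℝ × ℝ`. -/
def kg (z : ℝ × ℝ) : ℝ := √(5 - 2 * cos z.1 - 2 * cos z.2)

lemma kg_radicand_pos (z : ℝ × ℝ) : 0 < 5 - 2 * cos z.1 - 2 * cos z.2 := by
  linarith [cos_le_one z.1, cos_le_one z.2]

lemma kg_pos (z : ℝ × ℝ) : 0 < kg z := sqrt_pos.2 (kg_radicand_pos z)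

lemma kg_sq (z : ℝ × ℝ) : kg z ^ 2 = 5 - 2 * cos z.1 - 2 * cos z.2 :=
  sq_sqrt (kg_radicand_pos z).le

lemma smoothAt_cos_fst {z : ℝ × ℝ} : SmoothAt (fun z => cos z.1) z := smoothAt_fst.cos

lemma smoothAt_cos_snd {z : ℝ × ℝ} : SmoothAt (fun z => cos z.2) z := smoothAt_snd.cos

lemma smoothAt_kg (z : ℝ × ℝ) : SmoothAt kg z :=
  ((contDiffAt_const.sub (contDiffAt_const.mul smoothAt_cos_fst)).sub
    (contDiffAt_const.mul smoothAt_cos_snd)).sqrt (kg_radicand_pos z).ne'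

lemma hasDerivAt_kg_fst (x y : ℝ) :
    HasDerivAt (fun x => kg (x, y)) (sin x / kg (x, y)) x := by
  have h := ((((hasDerivAt_cos x).const_mul 2).const_sub 5).sub_const (2 * cos y)).sqrt
    (kg_radicand_pos (x, y)).ne'
  refine h.congr_deriv ?_
  change _ / (2 * kg (x, y)) = _
  have := (kg_pos (x, y)).ne'
  field_simp

lemma hasDerivAt_kg_snd (x y : ℝ) :
    HasDerivAt (fun y => kg (x, y)) (sin y / kg (x, y)) y := by
  have h := (((hasDerivAt_cos y).const_mul 2).const_sub (5 - 2 * cos x)).sqrt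
    (kg_radicand_pos (x, y)).ne'
  refine h.congr_deriv ?_
  change _ / (2 * kg (x, y)) = _
  have := (kg_pos (x, y)).ne'
  field_simp

lemma dx_kg : dx kg = fun z => sin z.1 / kg z :=
  funext fun z => (smoothAt_kg z).dx_eq (hasDerivAt_kg_fst z.1 z.2)

lemma dy_kg : dy kg = fun z => sin z.2 / kg z :=
  funext fun z => (smoothAt_kg z).dy_eq (hasDerivAt_kg_snd z.1 z.2)

/-- Numerator of the first pure second derivative of the dispersion relation. -/
def hessX (z : ℝ × ℝ) : ℝ := 5 * cos z.1 - cos z.1 ^ 2 - 2 * cos z.1 * cos z.2 - 1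

/-- Numerator of the second pure second derivative of the dispersion relation. -/
def hessY (z : ℝ × ℝ) : ℝ := 5 * cos z.2 - cos z.2 ^ 2 - 2 * cos z.1 * cos z.2 - 1

/-- Numerator of the Hessian determinant of the dispersion relation. -/
def hessD (z : ℝ × ℝ) : ℝ :=
  5 * cos z.1 * cos z.2 - cos z.1 ^ 2 * cos z.2 - cos z.1 * cos z.2 ^ 2 - cos z.1 - cos z.2

lemma hessX_mul_hessY (z : ℝ × ℝ) :
    hessX z * hessY z - sin z.1 ^ 2 * sin z.2 ^ 2 = hessD z * kg z ^ 2 := by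
  rw [kg_sq, sin_sq, sin_sq, hessX, hessY, hessD]
  ring

lemma dx_dx_kg : dx (dx kg) = fun z => hessX z / kg z ^ 3 := by
  funext z
  refine (smoothAt_kg z).dx.dx_eq ?_
  rw [dx_kg]
  have h0 := (kg_pos z).ne'
  refine ((hasDerivAt_sin z.1).div (hasDerivAt_kg_fst z.1 z.2) h0).congr_deriv ?_
  have h := kg_sq z
  change (cos z.1 * kg z - sin z.1 * (sin z.1 / kg z)) / kg z ^ 2 = _
  rw [hessX]
  field_simp
  rw [h, sin_sq]
  ring

lemma dy_dy_kg : dy (dy kg) = fun z => hessY z / kg z ^ 3 := by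
  funext z
  refine (smoothAt_kg z).dy.dy_eq ?_
  rw [dy_kg]
  have h0 := (kg_pos z).ne'
  refine ((hasDerivAt_sin z.2).div (hasDerivAt_kg_snd z.1 z.2) h0).congr_deriv ?_
  have h := kg_sq z
  change (cos z.2 * kg z - sin z.2 * (sin z.2 / kg z)) / kg z ^ 2 = _
  rw [hessY]
  field_simp
  rw [h, sin_sq]
  ring

lemma dy_dx_kg : dy (dx kg) = fun z => -(sin z.1 * sin z.2) / kg z ^ 3 := by
  funext z
  refine (smoothAt_kg z).dx.dy_eq ?_
  rw [dx_kg]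
  have h0 := (kg_pos z).ne'
  refine ((hasDerivAt_const z.2 (sin z.1)).div (hasDerivAt_kg_snd z.1 z.2) h0).congr_deriv ?_
  change (0 * kg z - sin z.1 * (sin z.2 / kg z)) / kg z ^ 2 = _
  field_simp
  ring

lemma dx_dy_kg : dx (dy kg) = fun z => -(sin z.1 * sin z.2) / kg z ^ 3 := by
  funext z
  refine (smoothAt_kg z).dy.dx_eq ?_
  rw [dy_kg]
  have h0 := (kg_pos z).ne'
  refine ((hasDerivAt_const z.1 (sin z.2)).div (hasDerivAt_kg_fst z.1 z.2) h0).congr_deriv ?_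
  change (0 * kg z - sin z.2 * (sin z.1 / kg z)) / kg z ^ 2 = _
  field_simp
  ring

lemma smoothAt_hessX (z : ℝ × ℝ) : SmoothAt hessX z :=
  (((contDiffAt_const.mul smoothAt_cos_fst).sub (smoothAt_cos_fst.pow 2)).sub
    ((contDiffAt_const.mul smoothAt_cos_fst).mul smoothAt_cos_snd)).sub contDiffAt_const

lemma smoothAt_hessY (z : ℝ × ℝ) : SmoothAt hessY z :=
  (((contDiffAt_const.mul smoothAt_cos_snd).sub (smoothAt_cos_snd.pow 2)).sub
    ((contDiffAt_const.mul smoothAt_cos_fst).mul smoothAt_cos_snd)).sub contDiffAt_const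

lemma smoothAt_hessD (z : ℝ × ℝ) : SmoothAt hessD z :=
  (((((contDiffAt_const.mul smoothAt_cos_fst).mul smoothAt_cos_snd).sub
    ((smoothAt_cos_fst.pow 2).mul smoothAt_cos_snd)).sub
    (smoothAt_cos_fst.mul (smoothAt_cos_snd.pow 2))).sub smoothAt_cos_fst).sub smoothAt_cos_snd

lemma hasDerivAt_hessX_fst (z : ℝ × ℝ) :
    HasDerivAt (fun x => hessX (x, z.2)) (-sin z.1 * (5 - 2 * cos z.1 - 2 * cos z.2)) z.1 := by
  have hc := hasDerivAt_cos z.1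
  refine ((((hc.const_mul 5).sub (hc.pow 2)).sub ((hc.const_mul 2).mul_const (cos z.2))).sub_const
    1).congr_deriv ?_
  norm_num
  ring

lemma hasDerivAt_hessX_snd (z : ℝ × ℝ) :
    HasDerivAt (fun y => hessX (z.1, y)) (2 * cos z.1 * sin z.2) z.2 := by
  have hc := hasDerivAt_cos z.2
  refine (((hc.const_mul (2 * cos z.1)).const_sub (5 * cos z.1 - cos z.1 ^ 2)).sub_const
    1).congr_deriv ?_
  ring

lemma hasDerivAt_hessY_fst (z : ℝ × ℝ) :
    HasDerivAt (fun x => hessY (x, z.2)) (2 * sin z.1 * cos z.2) z.1 := by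
  have hc := hasDerivAt_cos z.1
  refine ((((hc.const_mul 2).mul_const (cos z.2)).const_sub (5 * cos z.2 - cos z.2 ^ 2)).sub_const
    1).congr_deriv ?_
  ring

lemma hasDerivAt_hessY_snd (z : ℝ × ℝ) :
    HasDerivAt (fun y => hessY (z.1, y)) (-sin z.2 * (5 - 2 * cos z.1 - 2 * cos z.2)) z.2 := by
  have hc := hasDerivAt_cos z.2
  refine ((((hc.const_mul 5).sub (hc.pow 2)).sub (hc.const_mul (2 * cos z.1))).sub_const
    1).congr_deriv ?_
  norm_num
  ring

lemma dx_hessD (z : ℝ × ℝ) : dx hessD z = -sin z.1 * hessY z := by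
  have hc := hasDerivAt_cos z.1
  refine (smoothAt_hessD z).dx_eq ((((((hc.const_mul 5).mul_const (cos z.2)).sub
    ((hc.pow 2).mul_const (cos z.2))).sub (hc.mul_const (cos z.2 ^ 2))).sub hc).sub_const
    (cos z.2) |>.congr_deriv ?_)
  rw [hessY]
  norm_num
  ring

lemma dy_hessD (z : ℝ × ℝ) : dy hessD z = -sin z.2 * hessX z := by
  have hc := hasDerivAt_cos z.2
  refine (smoothAt_hessD z).dy_eq (((((hc.const_mul (5 * cos z.1)).sub
    (hc.const_mul (cos z.1 ^ 2))).sub ((hc.pow 2).const_mul (cos z.1))).sub_const (cos z.1)).sub hc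
    |>.congr_deriv ?_)
  rw [hessX]
  norm_num
  ring

lemma hessX_ne_zero_of_sin {z : ℝ × ℝ} (h : sin z.1 = 0) : hessX z ≠ 0 := by
  have h1 : cos z.1 ^ 2 = 1 := by rw [← sin_sq_add_cos_sq z.1, h]; ring
  have h2 := neg_one_le_cos z.2
  have h3 := cos_le_one z.2
  rw [hessX]
  rcases (mul_self_eq_one_iff (a := cos z.1)).1 (by rw [← sq]; exact h1) with h | h <;>
    rw [h] <;> intro h4 <;> linarith

lemma hessY_ne_zero_of_sin {z : ℝ × ℝ} (h : sin z.2 = 0) : hessY z ≠ 0 := by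
  have h1 : cos z.2 ^ 2 = 1 := by rw [← sin_sq_add_cos_sq z.2, h]; ring
  have h2 := neg_one_le_cos z.1
  have h3 := cos_le_one z.1
  rw [hessY]
  rcases (mul_self_eq_one_iff (a := cos z.2)).1 (by rw [← sq]; exact h1) with h | h <;>
    rw [h] <;> intro h4 <;> linarith

lemma dx_kg_nondegenerate (z : ℝ × ℝ) : dx (dx kg) z ≠ 0 ∨ dx (dx (dx kg)) z ≠ 0 := by
  have h0 := kg_pos z
  rw [dx_dx_kg]
  by_cases h : hessX z = 0
  · right
    have hs : sin z.1 ≠ 0 := fun hs => hessX_ne_zero_of_sin hs h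
    have hd : dx (fun z => hessX z / kg z ^ 3) z = -sin z.1 / kg z := by
      refine SmoothAt.dx_eq ((smoothAt_hessX z).div ((smoothAt_kg z).pow 3) (by positivity))
        (((hasDerivAt_hessX_fst z).div ((hasDerivAt_kg_fst z.1 z.2).pow 3)
          (pow_pos h0 3).ne').congr_deriv ?_)
      simp only [Pi.pow_apply, Prod.mk.eta, h, ← kg_sq]
      field_simp
      ring
    rw [hd]
    exact div_ne_zero (neg_ne_zero.2 hs) h0.ne'
  · exact Or.inl (div_ne_zero h (by positivity))

lemma dy_kg_nondegenerate (z : ℝ × ℝ) : dy (dy kg) z ≠ 0 ∨ dy (dy (dy kg)) z ≠ 0 := by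
  have h0 := kg_pos z
  rw [dy_dy_kg]
  by_cases h : hessY z = 0
  · right
    have hs : sin z.2 ≠ 0 := fun hs => hessY_ne_zero_of_sin hs h
    have hd : dy (fun z => hessY z / kg z ^ 3) z = -sin z.2 / kg z := by
      refine SmoothAt.dy_eq ((smoothAt_hessY z).div ((smoothAt_kg z).pow 3) (by positivity))
        (((hasDerivAt_hessY_snd z).div ((hasDerivAt_kg_snd z.1 z.2).pow 3)
          (pow_pos h0 3).ne').congr_deriv ?_)
      simp only [Pi.pow_apply, Prod.mk.eta, h, ← kg_sq]
      field_simp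
      ring
    rw [hd]
    exact div_ne_zero (neg_ne_zero.2 hs) h0.ne'
  · exact Or.inl (div_ne_zero h (by positivity))

lemma jac_dx_kg_dy_kg (z : ℝ × ℝ) : jac (dx kg) (dy kg) z = hessD z / kg z ^ 4 := by
  have h0 := (kg_pos z).ne'
  have h := hessX_mul_hessY z
  rw [jac, dx_dx_kg, dy_dy_kg, dy_dx_kg, dx_dy_kg]
  field_simp
  linear_combination h

lemma jac_dy_kg_dx_kg (z : ℝ × ℝ) : jac (dy kg) (dx kg) z = -(hessD z / kg z ^ 4) := by
  rw [← jac_dx_kg_dy_kg, jac, jac]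
  ring

lemma levelDeriv_dy_kg :
    levelDeriv (dx kg) Prod.snd (dy kg) = fun z => hessD z * (kg z * hessX z)⁻¹ := by
  funext z
  have h0 := (kg_pos z).ne'
  rw [levelDeriv, jac_snd, jac_dx_kg_dy_kg, dx_dx_kg]
  by_cases h : hessX z = 0
  · simp [h]
  · field_simp

lemma levelDeriv_dx_kg :
    levelDeriv (dy kg) Prod.fst (dx kg) = fun z => hessD z * (kg z * hessY z)⁻¹ := by
  funext z
  have h0 := (kg_pos z).ne'
  rw [levelDeriv, jac_fst, jac_dy_kg_dx_kg, dy_dy_kg]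
  by_cases h : hessY z = 0
  · simp [h]
  · field_simp

lemma levelDeriv_hessD {z : ℝ × ℝ} (h : hessX z ≠ 0) :
    levelDeriv (dx kg) Prod.snd hessD z
      = (hessX z ^ 2 + sin z.1 ^ 2 * hessY z) * (-sin z.2 / hessX z) := by
  have h0 := (kg_pos z).ne'
  rw [levelDeriv, jac_snd, jac, dx_dx_kg, dy_dx_kg, dx_hessD, dy_hessD]
  field_simp
  ring

lemma smoothAt_inv_kg_mul_hessX {z : ℝ × ℝ} (h : hessX z ≠ 0) :
    SmoothAt (fun z => (kg z * hessX z)⁻¹) z :=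
  ((smoothAt_kg z).mul (smoothAt_hessX z)).inv (mul_ne_zero (kg_pos z).ne' h)

lemma smoothAt_inv_kg_mul_hessY {z : ℝ × ℝ} (h : hessY z ≠ 0) :
    SmoothAt (fun z => (kg z * hessY z)⁻¹) z :=
  ((smoothAt_kg z).mul (smoothAt_hessY z)).inv (mul_ne_zero (kg_pos z).ne' h)

lemma add_eq_zero_of_cube_relation {a b : ℝ} (ha : a ^ 2 ≤ 1) (hb : b ^ 2 < 1)
    (h : a ^ 3 * (1 - b ^ 2) ^ 2 + b ^ 3 * (1 - a ^ 2) ^ 2 = 0) : a + b = 0 := by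
  by_contra hne
  have h2 : (a + b) * (a ^ 2 - a * b + b ^ 2 - 2 * a ^ 2 * b ^ 2 + a ^ 3 * b ^ 3) = 0 := by
    linear_combination h
  have h3 := (mul_eq_zero.1 h2).resolve_left hne
  have hu : |a * b| < 1 := by
    rw [← sq_lt_one_iff_abs_lt_one, mul_pow]
    nlinarith [sq_nonneg a, sq_nonneg b]
  obtain ⟨h4, h5⟩ := abs_lt.1 hu
  rcases le_or_gt (a * b) 0 with hs | hs
  · have h6 : (a + b) ^ 2 + (-(a * b)) * (3 + -(a * b)) * (1 + a * b) = 0 := by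
      linear_combination h3
    have h7 : 0 < (a + b) ^ 2 := by positivity
    have h8 : 0 ≤ (-(a * b)) * (3 + -(a * b)) * (1 + a * b) :=
      mul_nonneg (mul_nonneg (by linarith) (by linarith)) (by linarith)
    linarith
  · have h6 : (a - b) ^ 2 + a * b * (1 - a * b) ^ 2 = 0 := by
      linear_combination h3
    have h7 : 0 < a * b * (1 - a * b) ^ 2 := mul_pos hs (pow_pos (by linarith) 2)
    nlinarith [sq_nonneg (a - b)]

/-- At a degenerate point which is not the centre, the degeneracy is of fold type. -/
lemma fold_ne_zero {z : ℝ × ℝ} (hD : hessD z = 0) (hX : hessX z ≠ 0)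
    (hz : ¬(cos z.1 = 0 ∧ cos z.2 = 0)) :
    sin z.2 ≠ 0 ∧ hessX z ^ 2 + sin z.1 ^ 2 * hessY z ≠ 0 := by
  have h1 := hessX_mul_hessY z
  rw [hD, zero_mul, sub_eq_zero] at h1
  have hs : sin z.2 ≠ 0 := by
    intro hs
    rw [hs] at h1
    exact mul_ne_zero hX (hessY_ne_zero_of_sin hs) (by rw [h1]; ring)
  refine ⟨hs, fun hR => hz ?_⟩
  have h2 : hessX z ^ 3 + (sin z.1 ^ 2) ^ 2 * sin z.2 ^ 2 = 0 := by
    linear_combination hessX z * hR - sin z.1 ^ 2 * h1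
  have h3 : cos z.2 * hessX z = cos z.1 * sin z.2 ^ 2 := by
    rw [sin_sq]; unfold hessX; unfold hessD at hD; linear_combination hD
  have h4 : cos z.1 ^ 3 * (sin z.2 ^ 2) ^ 2 + cos z.2 ^ 3 * (sin z.1 ^ 2) ^ 2 = 0 := by
    have : sin z.2 ^ 2 * (cos z.1 ^ 3 * (sin z.2 ^ 2) ^ 2 + cos z.2 ^ 3 * (sin z.1 ^ 2) ^ 2)
        = 0 := by
      have h5 : (cos z.2 * hessX z) ^ 3 = (cos z.1 * sin z.2 ^ 2) ^ 3 := by rw [h3]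
      linear_combination cos z.2 ^ 3 * h2 - h5
    exact (mul_eq_zero.1 this).resolve_left (pow_ne_zero 2 hs)
  rw [sin_sq, sin_sq] at h4
  have hb : cos z.2 ^ 2 < 1 := by
    have : 0 < sin z.2 ^ 2 := by positivity
    rw [sin_sq] at this; linarith
  have hab := add_eq_zero_of_cube_relation (cos_sq_le_one z.1) hb h4
  have hb' : cos z.2 = -cos z.1 := by linarith
  unfold hessD at hD
  rw [hb'] at hD ⊢
  have : cos z.1 ^ 2 = 0 := by linear_combination (-1 / 5) * hD
  simpa using this

lemma exists_lintegral_kg_le {z₀ : ℝ × ℝ} (hz : ¬(cos z₀.1 = 0 ∧ cos z₀.2 = 0)) :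
    ∃ U ∈ nhds z₀, ∃ C > 0, ∀ δ > 0, ∀ σ₁ σ₂ : ℝ,
      ∫⁻ z in U, ENNReal.ofReal (1 / (δ ^ 2 + (dx kg z - σ₁) ^ 2 + (dy kg z - σ₂) ^ 2))
        ≤ ENNReal.ofReal (C * δ ^ (-(1 / 2) : ℝ)) := by
  have h0 := kg_pos z₀
  have hp : ∀ᶠ z in nhds z₀, SmoothAt (dx kg) z :=
    Filter.Eventually.of_forall fun z => (smoothAt_kg z).dx
  have hq : ∀ᶠ z in nhds z₀, SmoothAt (dy kg) z :=
    Filter.Eventually.of_forall fun z => (smoothAt_kg z).dy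
  by_cases hD : hessD z₀ = 0
  · by_cases hX : hessX z₀ = 0
    · have hs := hessX_mul_hessY z₀
      have hs1 : sin z₀.1 ≠ 0 := fun h => hessX_ne_zero_of_sin h hX
      have hs2 : sin z₀.2 = 0 := by
        rw [hD, hX] at hs
        have : sin z₀.1 ^ 2 * sin z₀.2 ^ 2 = 0 := by linear_combination -hs
        simpa [hs1] using this
      have hY := hessY_ne_zero_of_sin hs2
      obtain ⟨U, hU, C, hC, H⟩ := exists_lintegral_inv_sq_le (τ := Prod.fst) (k := 2)
        (Or.inr rfl) hq hp (Filter.Eventually.of_forall fun z => smoothAt_fst)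
        (by rw [jac_fst, dy_dy_kg]; exact neg_ne_zero.2 (div_ne_zero hY (by positivity)))
        (by
          rw [Function.iterate_succ_apply', Function.iterate_one, levelDeriv_dx_kg,
            levelDeriv_mul (smoothAt_hessD z₀) (smoothAt_inv_kg_mul_hessY hY), hD, zero_mul,
            add_zero, levelDeriv, jac_fst, jac, dx_dy_kg, dy_dy_kg, dx_hessD, dy_hessD, hs2]
          simp only [mul_zero, neg_zero, zero_mul, zero_sub]
          have h3 : hessY z₀ / kg z₀ ^ 3 ≠ 0 := div_ne_zero hY (by positivity)
          exact mul_ne_zero (div_ne_zero (neg_ne_zero.2 (mul_ne_zero h3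
            (mul_ne_zero (neg_ne_zero.2 hs1) hY))) (neg_ne_zero.2 h3))
            (inv_ne_zero (mul_ne_zero h0.ne' hY)))
      refine ⟨U, hU, C, hC, fun δ hδ σ₁ σ₂ => le_of_eq_of_le ?_ (H δ hδ σ₂ σ₁)⟩
      simp only [add_right_comm]
    · obtain ⟨h1, h2⟩ := fold_ne_zero hD hX hz
      refine exists_lintegral_inv_sq_le (τ := Prod.snd) (k := 2) (Or.inr rfl) hp hq
        (Filter.Eventually.of_forall fun z => smoothAt_snd)
        (by rw [jac_snd, dx_dx_kg]; exact div_ne_zero hX (by positivity)) ?_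
      rw [Function.iterate_succ_apply', Function.iterate_one, levelDeriv_dy_kg,
        levelDeriv_mul (smoothAt_hessD z₀) (smoothAt_inv_kg_mul_hessX hX), hD, zero_mul,
        add_zero, levelDeriv_hessD hX]
      exact mul_ne_zero (mul_ne_zero h2 (div_ne_zero (neg_ne_zero.2 h1) hX))
        (inv_ne_zero (mul_ne_zero h0.ne' hX))
  · have hJ : jac (dx kg) (dy kg) z₀ ≠ 0 := by
      rw [jac_dx_kg_dy_kg]; exact div_ne_zero hD (by positivity)
    refine exists_lintegral_inv_sq_le (τ := dy kg) (k := 1) (Or.inl rfl) hp hq hq hJ ?_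
    rw [Function.iterate_one, levelDeriv, div_self hJ]
    exact one_ne_zero

lemma third_levelDeriv_ne_zero {z₀ : ℝ × ℝ} (h1 : cos z₀.1 = 0) (h2 : cos z₀.2 = 0) :
    (levelDeriv (dx kg) Prod.snd)^[3] (dy kg) z₀ ≠ 0 := by
  have h0 := kg_pos z₀
  have hs1 : sin z₀.1 ^ 2 = 1 := by rw [sin_sq, h1]; ring
  have hs2 : sin z₀.2 ^ 2 = 1 := by rw [sin_sq, h2]; ring
  have hX : hessX z₀ = -1 := by rw [hessX, h1]; ring
  have hY : hessY z₀ = -1 := by rw [hessY, h1, h2]; ring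
  have hD : hessD z₀ = 0 := by rw [hessD, h1, h2]; ring
  have hX0 : hessX z₀ ≠ 0 := by rw [hX]; norm_num
  have hne : ∀ᶠ z in nhds z₀, hessX z ≠ 0 :=
    (smoothAt_hessX z₀).continuousAt.eventually_ne hX0
  set u : ℝ × ℝ → ℝ := fun z => (kg z * hessX z)⁻¹ with hu
  set R : ℝ × ℝ → ℝ := fun z => hessX z ^ 2 + sin z.1 ^ 2 * hessY z with hR
  set w : ℝ × ℝ → ℝ := fun z => -sin z.2 / hessX z * u z with hw
  have hus := smoothAt_inv_kg_mul_hessX hX0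
  have hRs : SmoothAt R z₀ :=
    ((smoothAt_hessX z₀).pow 2).add ((smoothAt_fst.sin.pow 2).mul (smoothAt_hessY z₀))
  have hws : SmoothAt w z₀ := (smoothAt_snd.sin.neg.div (smoothAt_hessX z₀) hX0).mul hus
  have hR0 : R z₀ = 0 := by simp only [hR, hX, hY, hs1]; norm_num
  have hXu : SmoothAt (levelDeriv (dx kg) Prod.snd u) z₀ :=
    (smoothAt_kg z₀).dx.levelDeriv smoothAt_snd hus (by
      rw [jac_snd, dx_dx_kg]; exact div_ne_zero hX0 (by positivity))
  have hXX : levelDeriv (dx kg) Prod.snd (fun z => hessD z * u z) =ᶠ[nhds z₀]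
      fun z => R z * w z + hessD z * levelDeriv (dx kg) Prod.snd u z := by
    filter_upwards [hne] with z hz
    rw [levelDeriv_mul (smoothAt_hessD z) (smoothAt_inv_kg_mul_hessX hz), levelDeriv_hessD hz]
    simp only [hR, hw]
    ring
  have hRx : dx R z₀ = 10 * sin z₀.1 := by
    refine hRs.dx_eq ((((hasDerivAt_hessX_fst z₀).pow 2).add
      (((hasDerivAt_sin z₀.1).pow 2).mul (hasDerivAt_hessY_fst z₀))).congr_deriv ?_)
    simp [h1, h2, hX]
    ring
  have hRy : dy R z₀ = -5 * sin z₀.2 := by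
    refine hRs.dy_eq ((((hasDerivAt_hessX_snd z₀).pow 2).add
      ((hasDerivAt_hessY_snd z₀).const_mul (sin z₀.1 ^ 2))).congr_deriv ?_)
    simp [h1, h2, hs1]
    ring
  have hXR : levelDeriv (dx kg) Prod.snd R z₀ = -15 * sin z₀.2 := by
    rw [levelDeriv, jac_snd, jac, dx_dx_kg, dy_dx_kg, hRx, hRy]
    beta_reduce
    rw [hX]
    field_simp
    rw [hs1]
    ring
  have hs20 : sin z₀.2 ≠ 0 := fun h => by rw [h] at hs2; norm_num at hs2
  rw [Function.iterate_succ_apply', Function.iterate_succ_apply', Function.iterate_one,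
    levelDeriv_dy_kg, levelDeriv_congr hXX, levelDeriv_add (hRs.mul hws)
      ((smoothAt_hessD z₀).mul hXu), levelDeriv_mul hRs hws, levelDeriv_mul (smoothAt_hessD z₀) hXu,
    levelDeriv_hessD hX0, hXR, hD]
  change -15 * sin z₀.2 * w z₀ + R z₀ * _ + (R z₀ * _ * _ + 0 * _) ≠ 0
  rw [hR0]
  simp only [zero_mul, add_zero]
  exact mul_ne_zero (mul_ne_zero (by norm_num) hs20) (mul_ne_zero
    (div_ne_zero (neg_ne_zero.2 hs20) hX0) (inv_ne_zero (mul_ne_zero h0.ne' hX0)))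

theorem localDecay_kg (z₀ : ℝ × ℝ) : LocalDecay kg z₀ := by
  have h0 := kg_pos z₀
  have hW : ∀ᶠ z in nhds z₀, SmoothAt kg z := Filter.Eventually.of_forall smoothAt_kg
  by_cases hz : cos z₀.1 = 0 ∧ cos z₀.2 = 0
  · obtain ⟨h1, h2⟩ := hz
    have hs1 : sin z₀.1 ≠ 0 := fun h => by
      have := sin_sq_add_cos_sq z₀.1
      rw [h, h1] at this; norm_num at this
    have hs2 : sin z₀.2 ≠ 0 := fun h => by
      have := sin_sq_add_cos_sq z₀.2
      rw [h, h2] at this; norm_num at this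
    refine localDecay_of_third_levelDeriv_ne_zero hW
      (Filter.Eventually.of_forall fun z => by rw [dy_dx_kg, dx_dy_kg]) ?_ ?_
      (third_levelDeriv_ne_zero h1 h2)
    · rw [dx_dx_kg]
      exact div_ne_zero (by rw [hessX, h1]; norm_num) (by positivity)
    · rw [dy_dx_kg]
      exact div_ne_zero (neg_ne_zero.2 (mul_ne_zero hs1 hs2)) (by positivity)
  · exact localDecay_of_lintegral_inv_sq_le hW (dx_kg_nondegenerate z₀) (dy_kg_nondegenerate z₀)
      (exists_lintegral_kg_le hz)

/-- Uniform decay of order `3/4` for the integrals over the rectangle with corners `a`, `b`. -/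
def BoxDecay (W : ℝ × ℝ → ℝ) (a b : ℝ × ℝ) : Prop :=
  ∃ C > 0, ∀ lam ≥ (1 : ℝ), ∀ σ₁ σ₂ : ℝ,
    ‖∫ z in Set.Icc a b, osc lam (tilt W σ₁ σ₂) z‖ ≤ C * lam ^ (-(3 / 4) : ℝ)

lemma continuous_osc_tilt {W : ℝ × ℝ → ℝ} (hW : Continuous W) (lam σ₁ σ₂ : ℝ) :
    Continuous (osc lam (tilt W σ₁ σ₂)) := by
  unfold osc tilt
  fun_prop

lemma norm_setIntegral_union_le {f : ℝ × ℝ → ℂ} (hf : Continuous f) {a b a' b' : ℝ × ℝ}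
    (h : volume (Set.Icc a b ∩ Set.Icc a' b') = 0) :
    ‖∫ z in Set.Icc a b ∪ Set.Icc a' b', f z‖
      ≤ ‖∫ z in Set.Icc a b, f z‖ + ‖∫ z in Set.Icc a' b', f z‖ := by
  rw [setIntegral_union₀ h measurableSet_Icc.nullMeasurableSet
    hf.continuousOn.integrableOn_Icc hf.continuousOn.integrableOn_Icc]
  exact norm_add_le _ _

lemma BoxDecay.union {W : ℝ × ℝ → ℝ} (hW : Continuous W) {a b a' b' c d : ℝ × ℝ}
    (h : BoxDecay W a b) (h' : BoxDecay W a' b')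
    (h0 : volume (Set.Icc a b ∩ Set.Icc a' b') = 0)
    (hu : Set.Icc c d = Set.Icc a b ∪ Set.Icc a' b') : BoxDecay W c d := by
  obtain ⟨C, hC, H⟩ := h
  obtain ⟨C', hC', H'⟩ := h'
  refine ⟨C + C', by positivity, fun lam hl σ₁ σ₂ => ?_⟩
  rw [hu, add_mul]
  exact (norm_setIntegral_union_le (continuous_osc_tilt hW lam σ₁ σ₂) h0).trans
    (add_le_add (H lam hl σ₁ σ₂) (H' lam hl σ₁ σ₂))

lemma volume_singleton_prod_univ (m : ℝ) :
    volume (({m} : Set ℝ) ×ˢ (Set.univ : Set ℝ)) = 0 := by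
  rw [Measure.volume_eq_prod, Measure.prod_prod, volume_singleton, zero_mul]

lemma volume_univ_prod_singleton (m : ℝ) :
    volume ((Set.univ : Set ℝ) ×ˢ ({m} : Set ℝ)) = 0 := by
  rw [Measure.volume_eq_prod, Measure.prod_prod, volume_singleton, mul_zero]

lemma BoxDecay.split_fst {W : ℝ × ℝ → ℝ} (hW : Continuous W) {a b : ℝ × ℝ} {m : ℝ}
    (ha : a.1 ≤ m) (hb : m ≤ b.1) (h : BoxDecay W a (m, b.2)) (h' : BoxDecay W (m, a.2) b) :
    BoxDecay W a b := by
  refine h.union hW h' (measure_mono_null (fun z hz => ?_) (volume_singleton_prod_univ m)) ?_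
  · exact ⟨le_antisymm hz.1.2.1 hz.2.1.1, trivial⟩
  · ext z
    simp only [Set.mem_union, Set.mem_Icc, Prod.le_def]
    constructor
    · rintro ⟨h1, h2⟩
      rcases le_total z.1 m with h3 | h3
      · exact Or.inl ⟨h1, h3, h2.2⟩
      · exact Or.inr ⟨⟨h3, h1.2⟩, h2⟩
    · rintro (⟨h1, h2⟩ | ⟨h1, h2⟩)
      · exact ⟨h1, h2.1.trans hb, h2.2⟩
      · exact ⟨⟨ha.trans h1.1, h1.2⟩, h2⟩

lemma BoxDecay.split_snd {W : ℝ × ℝ → ℝ} (hW : Continuous W) {a b : ℝ × ℝ} {m : ℝ}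
    (ha : a.2 ≤ m) (hb : m ≤ b.2) (h : BoxDecay W a (b.1, m)) (h' : BoxDecay W (a.1, m) b) :
    BoxDecay W a b := by
  refine h.union hW h' (measure_mono_null (fun z hz => ?_) (volume_univ_prod_singleton m)) ?_
  · exact ⟨trivial, le_antisymm hz.1.2.2 hz.2.1.2⟩
  · ext z
    simp only [Set.mem_union, Set.mem_Icc, Prod.le_def]
    constructor
    · rintro ⟨h1, h2⟩
      rcases le_total z.2 m with h3 | h3
      · exact Or.inl ⟨h1, h2.1, h3⟩
      · exact Or.inr ⟨⟨h1.1, h3⟩, h2⟩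
    · rintro (⟨h1, h2⟩ | ⟨h1, h2⟩)
      · exact ⟨h1, h2.1, h2.2.trans hb⟩
      · exact ⟨⟨h1.1, ha.trans h1.2⟩, h2⟩

lemma boxDecay_of_small {W : ℝ × ℝ → ℝ} (hW : Continuous W) {a₀ b₀ : ℝ × ℝ} {ε : ℝ}
    (h : ∀ a b, a₀ ≤ a → a ≤ b → b ≤ b₀ → b.1 - a.1 ≤ ε → b.2 - a.2 ≤ ε → BoxDecay W a b)
    (n : ℕ) : ∀ a b, a₀ ≤ a → a ≤ b → b ≤ b₀ → b.1 - a.1 ≤ 2 ^ n * ε → b.2 - a.2 ≤ 2 ^ n * ε →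
      BoxDecay W a b := by
  induction n with
  | zero => simpa using h
  | succ n ih =>
    have key : ∀ a b : ℝ × ℝ, a₀ ≤ a → a ≤ b → b ≤ b₀ → b.1 - a.1 ≤ 2 ^ n * ε →
        b.2 - a.2 ≤ 2 ^ (n + 1) * ε → BoxDecay W a b := by
      rintro ⟨a₁, a₂⟩ ⟨b₁, b₂⟩ ⟨h1, h2⟩ ⟨h3, h4⟩ ⟨h5, h6⟩ h7 h8
      simp only at h1 h2 h3 h4 h5 h6 h7 h8
      rw [pow_succ] at h8
      refine BoxDecay.split_snd hW (m := (a₂ + b₂) / 2) ?_ ?_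
        (ih _ _ ⟨?_, ?_⟩ ⟨?_, ?_⟩ ⟨?_, ?_⟩ ?_ ?_) (ih _ _ ⟨?_, ?_⟩ ⟨?_, ?_⟩ ⟨?_, ?_⟩ ?_ ?_) <;>
        simp only <;> linarith
    rintro ⟨a₁, a₂⟩ ⟨b₁, b₂⟩ ⟨h1, h2⟩ ⟨h3, h4⟩ ⟨h5, h6⟩ h7 h8
    simp only at h1 h2 h3 h4 h5 h6 h7 h8
    rw [pow_succ] at h7
    refine BoxDecay.split_fst hW (m := (a₁ + b₁) / 2) ?_ ?_
      (key _ _ ⟨?_, ?_⟩ ⟨?_, ?_⟩ ⟨?_, ?_⟩ ?_ ?_) (key _ _ ⟨?_, ?_⟩ ⟨?_, ?_⟩ ⟨?_, ?_⟩ ?_ ?_) <;>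
      simp only <;> linarith

lemma boxDecay_of_localDecay {W : ℝ × ℝ → ℝ} (hW : Continuous W) (h : ∀ z, LocalDecay W z)
    {a₀ b₀ : ℝ × ℝ} (hab : a₀ ≤ b₀) : BoxDecay W a₀ b₀ := by
  choose U hU hD using h
  obtain ⟨δ, hδ, H⟩ := lebesgue_number_lemma_of_metric (isCompact_Icc (a := a₀) (b := b₀))
    (c := fun z => interior (U z)) (fun z => isOpen_interior)
    (fun z _ => Set.mem_iUnion.2 ⟨z, mem_interior_iff_mem_nhds.2 (hU z)⟩)
  have hsmall : ∀ a b : ℝ × ℝ, a₀ ≤ a → a ≤ b → b ≤ b₀ → b.1 - a.1 ≤ δ / 2 →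
      b.2 - a.2 ≤ δ / 2 → BoxDecay W a b := by
    intro a b h1 h2 h3 h4 h5
    obtain ⟨i, hi⟩ := H a ⟨h1, h2.trans h3⟩
    obtain ⟨C, hC, hCb⟩ := hD i
    refine ⟨C, hC, hCb a b h2 fun z hz => interior_subset (hi ?_)⟩
    obtain ⟨⟨h6, h7⟩, ⟨h8, h9⟩⟩ := hz
    rw [Metric.mem_ball, Prod.dist_eq, Real.dist_eq, Real.dist_eq,
      abs_of_nonneg (by linarith), abs_of_nonneg (by linarith), max_lt_iff]
    constructor <;> linarith
  obtain ⟨n, hn⟩ := pow_unbounded_of_one_lt (max (b₀.1 - a₀.1) (b₀.2 - a₀.2) / (δ / 2))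
    (one_lt_two : (1 : ℝ) < 2)
  rw [div_lt_iff₀ (by positivity), max_lt_iff] at hn
  exact boxDecay_of_small hW hsmall n a₀ b₀ le_rfl hab le_rfl hn.1.le hn.2.le

lemma osc_neg (lam : ℝ) (Φ : ℝ × ℝ → ℝ) (z : ℝ × ℝ) :
    osc (-lam) Φ z = (starRingEnd ℂ) (osc lam Φ z) := by
  rw [osc, osc, ← Complex.exp_conj, map_mul, Complex.conj_I, Complex.conj_ofReal]
  push_cast
  ring_nf

lemma norm_setIntegral_osc_neg (lam : ℝ) (Φ : ℝ × ℝ → ℝ) (s : Set (ℝ × ℝ)) :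
    ‖∫ z in s, osc (-lam) Φ z‖ = ‖∫ z in s, osc lam Φ z‖ := by
  simp only [osc_neg]
  rw [integral_conj, RCLike.norm_conj]

lemma BoxDecay.exists_forall {W : ℝ × ℝ → ℝ} {a b : ℝ × ℝ} (h : BoxDecay W a b) :
    ∃ C > 0, ∀ lam σ₁ σ₂ : ℝ,
      ‖∫ z in Set.Icc a b, osc lam (tilt W σ₁ σ₂) z‖ ≤ C * (1 + |lam|) ^ (-(3 / 4) : ℝ) := by
  obtain ⟨C, hC, H⟩ := h
  set V := volume.real (Set.Icc a b)
  have hV : 0 ≤ V := measureReal_nonneg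
  set c : ℝ := (2 : ℝ) ^ (-(3 / 4) : ℝ)
  have hc : 0 < c := by positivity
  refine ⟨(C + V) / c, by positivity, fun lam σ₁ σ₂ => ?_⟩
  have hpow : ∀ t : ℝ, 0 < t → 1 + |lam| ≤ 2 * t →
      t ^ (-(3 / 4) : ℝ) * c ≤ (1 + |lam|) ^ (-(3 / 4) : ℝ) := by
    intro t ht h2
    rw [mul_comm, ← mul_rpow zero_le_two ht.le]
    exact rpow_le_rpow_of_nonpos (by positivity) h2 (by norm_num)
  rw [div_mul_eq_mul_div, le_div_iff₀ hc]
  have habs : ‖∫ z in Set.Icc a b, osc lam (tilt W σ₁ σ₂) z‖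
      = ‖∫ z in Set.Icc a b, osc |lam| (tilt W σ₁ σ₂) z‖ := by
    rcases abs_choice lam with h | h <;> rw [h]
    rw [norm_setIntegral_osc_neg]
  rcases le_total 1 |lam| with hl | hl
  · have h1 : 0 < |lam| := by linarith
    calc _ ≤ C * |lam| ^ (-(3 / 4) : ℝ) * c := by
          rw [habs]; gcongr; exact H _ hl σ₁ σ₂
      _ = C * (|lam| ^ (-(3 / 4) : ℝ) * c) := mul_assoc _ _ _
      _ ≤ (C + V) * (1 + |lam|) ^ (-(3 / 4) : ℝ) := by
          gcongr
          · linarith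
          · exact hpow _ h1 (by linarith)
  · have h1 := hpow 1 one_pos (by linarith)
    rw [one_rpow, one_mul] at h1
    have h2 : ‖∫ z in Set.Icc a b, osc lam (tilt W σ₁ σ₂) z‖ ≤ 1 * V :=
      norm_setIntegral_le_of_norm_le_const isCompact_Icc.measure_lt_top
        fun z _ => (norm_osc _ _ _).le
    rw [one_mul] at h2
    gcongr
    linarith

lemma continuous_kg : Continuous kg := by
  unfold kg
  fun_prop

lemma oscIntJ_two_eq (lam : ℝ) (s : Fin 2 → ℝ) :
    oscIntJ 2 lam s
      = ∫ z in Set.Icc (0 : ℝ × ℝ) (2 * π, 2 * π), osc lam (tilt kg (s 0) (s 1)) z := by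
  rw [← (volume_preserving_finTwoArrow ℝ).setIntegral_preimage_emb
    MeasurableEquiv.finTwoArrow.measurableEmbedding, oscIntJ]
  have hs : MeasurableEquiv.finTwoArrow ⁻¹' Set.Icc (0 : ℝ × ℝ) (2 * π, 2 * π) = cube 2 := by
    ext x
    simp [cube, Pi.le_def, Fin.forall_fin_two, Prod.le_def, MeasurableEquiv.finTwoArrow_apply]
  rw [hs]
  congr 1
  funext x
  have hk : omegaKG 2 x = kg (x 0, x 1) := by
    rw [omegaKG, kg, Fin.sum_univ_two]
    ring_nf
  rw [osc, tilt, MeasurableEquiv.finTwoArrow_apply, hk, Fin.sum_univ_two]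

/-- Sharp decay of the oscillatory integral with the `d = 2` discrete Klein--Gordon
phase `Φ(x,s) = ω(x) − s·x`, uniformly in the velocity parameter `s`. -/
theorem oscillatory_decay_d2 :
    ∃ C > 0, ∀ (lam : ℝ) (s : Fin 2 → ℝ),
      ‖oscIntJ 2 lam s‖ ≤ C * (1 + |lam|) ^ (-(3 : ℝ)/4) := by
  have hπ : (0 : ℝ) ≤ 2 * π := by positivity
  obtain ⟨C, hC, H⟩ := (boxDecay_of_localDecay continuous_kg localDecay_kg
    (a₀ := 0) (b₀ := (2 * π, 2 * π)) ⟨hπ, hπ⟩).exists_forall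
  refine ⟨C, hC, fun lam s => ?_⟩
  rw [oscIntJ_two_eq, neg_div]
  exact H lam (s 0) (s 1)
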